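/- arXiv:math/9601219 — 2 statements merged into one kernel-verified Lean document; each statement's English description precedes it below -/
import Mathlib

section
/- Assume λ = μ⁺ where μ is a cardinal with μ > cf(μ) = κ > ℵ₀, and assume that for some ordinal θ with κ < θ < λ, θ has the weak reflection property for κ. Then the restricted club filter D_λ↾S^λ_κ is not λ⁺-saturated. -/
/-- `C` is a closed unbounded (club) subset of the ordinal `δ`. -/
def IsClubIn (C : Set Ordinal) (δ : Ordinal) : Prop :=
  (∀ x ∈ C, x < δ) ∧ (∀ β < δ, ∃ γ ∈ C, β < γ) ∧
  (∀ α, 0 < α → α < δ → (∀ β < α, ∃ γ ∈ C, β < γ ∧ γ < α) → α ∈ C)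

/-- `S` is stationary in the ordinal `δ`: it meets every club subset of `δ`. -/
def IsStatIn (S : Set Ordinal) (δ : Ordinal) : Prop :=
  ∀ C, IsClubIn C δ → (S ∩ C).Nonempty

/-- `S^η_χ`: the set of ordinals below `η` of cofinality `χ`. -/
def Sset (η : Ordinal) (χ : Cardinal) : Set Ordinal :=
  {δ | δ < η ∧ Ordinal.cof δ = χ}

/-- `η` has the strong non-reflection property for `χ`: there is `h : η → χ`
which is strictly increasing on a club of every `δ ∈ S^η_χ`. -/
def SNR (η : Ordinal) (χ : Cardinal) : Prop :=
  ∃ h : Ordinal → Ordinal, (∀ α < η, h α < χ.ord) ∧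
    ∀ δ ∈ Sset η χ, ∃ C, IsClubIn C δ ∧ StrictMonoOn h C

/-- The club filter on `λ`, as a family of subsets of `Set.Iio λ`. -/
def ClubFilter (lam : Ordinal) : Set (Set Ordinal) :=
  {X | X ⊆ Set.Iio lam ∧ ∃ C, IsClubIn C lam ∧ C ⊆ X}

/-- The restriction `D↾S = {X ∩ S : X ∈ D}` of a filter `D` to `S`. -/
def RestFilter (D : Set (Set Ordinal)) (S : Set Ordinal) : Set (Set Ordinal) :=
  {Y | ∃ X ∈ D, Y = X ∩ S}

/-- `D` (a filter on the base set `B`) is `σ`-saturated: there do not exist `σ`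
many `D`-positive sets any two of which have intersection in the dual ideal.
(A set `A ⊆ B` is in the dual ideal iff `B \ A ∈ D`.) -/
def SatOn (B : Set Ordinal) (D : Set (Set Ordinal)) (σ : Ordinal) : Prop :=
  ¬ ∃ A : Ordinal → Set Ordinal,
      (∀ i < σ, A i ⊆ B ∧ (B \ A i) ∉ D) ∧
      (∀ i j, i < σ → j < σ → i ≠ j → (B \ (A i ∩ A j)) ∈ D)


namespace WR
open Ordinal Cardinal Set Order
universe u

theorem bdd {δ η : Ordinal.{u}} (h : η.card < δ.cof) (φ : Ordinal.{u} → Ordinal.{u})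
    (hφ : ∀ x < η, φ x < δ) : ∃ b < δ, ∀ x < η, φ x < b :=
  ⟨blsub η (fun x _ => φ x), blsub_lt_ord h hφ, fun x hx => lt_blsub (fun x _ => φ x) x hx⟩

theorem bddT {ι : Type (u+1)} {δ : Ordinal.{u}} (h : #ι < Cardinal.lift.{u+1} δ.cof)
    (φ : ι → Ordinal.{u}) (hφ : ∀ i, φ i < δ) : ∃ b < δ, ∀ i, φ i < b := by
  have hs : #(range φ) < Cardinal.lift.{u+1} δ.cof := lt_of_le_of_lt mk_range_le h
  have hb : BddAbove ((fun x => x + 1) '' range φ) := by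
    refine ⟨δ, ?_⟩
    rintro _ ⟨_, ⟨i, rfl⟩, rfl⟩
    exact Order.add_one_le_of_lt (hφ i)
  refine ⟨sSup ((fun x => x + 1) '' range φ), ?_, fun i => ?_⟩
  · apply sSup_add_one_lt_of_lt_cof (by rw [← lift_cof]; exact hs)
    rintro _ ⟨i, rfl⟩
    exact hφ i
  · exact lt_of_lt_of_le (lt_add_one _) (le_csSup hb ⟨_, ⟨i, rfl⟩, rfl⟩)

theorem lim_of {a : Ordinal.{u}} (h0 : 0 < a) (h : ∀ b < a, ∃ c < a, b < c) : IsSuccLimit a := by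
  refine ⟨by simpa using h0.ne', ?_⟩
  intro b hb
  obtain ⟨c, hc, hbc⟩ := h b hb.lt
  exact hb.2 hbc hc

theorem lim_succ {a b : Ordinal.{u}} (h : IsSuccLimit a) (hb : b < a) : b + 1 < a :=
  h.add_one_lt hb

theorem lim_pos {a : Ordinal.{u}} (h : IsSuccLimit a) : 0 < a := h.bot_lt

theorem lim_cof {a : Ordinal.{u}} (h : ℵ₀ ≤ a.cof) : IsSuccLimit a := aleph0_le_cof.1 h

theorem cases3 (a : Ordinal.{u}) : a = 0 ∨ (∃ b, a = b + 1) ∨ IsSuccLimit a := by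
  rcases zero_or_succ_or_isSuccLimit a with h | h | h
  · exact Or.inl h
  · obtain ⟨b, rfl⟩ := h
    exact Or.inr (Or.inl ⟨b, rfl⟩)
  · exact Or.inr (Or.inr h)

theorem iter {δ : Ordinal.{u}} (h : ℵ₀ < δ.cof) (F : Ordinal.{u} → Ordinal.{u})
    (hF : ∀ x < δ, F x < δ) {β : Ordinal.{u}} (hβ : β < δ) :
    ∃ α < δ, β < α ∧ ∀ x < α, ∃ y < α, x < y ∧ F y < α := by
  have hl : IsSuccLimit δ := lim_cof h.le
  let x : ℕ → Ordinal.{u} := fun n => Nat.rec β (fun _ y => max y (F y) + 1) n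
  have hx : ∀ n, x n < δ := by
    intro n
    induction n with
    | zero => exact hβ
    | succ n ih => exact lim_succ hl (max_lt ih (hF _ ih))
  have hs : ∀ n, x n < x (n+1) := fun n => lt_of_le_of_lt (le_max_left _ _) (lt_add_one _)
  have hf : ∀ n, F (x n) < x (n+1) := fun n => lt_of_le_of_lt (le_max_right _ _) (lt_add_one _)
  have hb : BddAbove (range x) := ⟨δ, by rintro _ ⟨n, rfl⟩; exact (hx n).le⟩
  have hlt : ∀ n, x n < ⨆ n, x n := fun n => (hs n).trans_le (le_ciSup (f := x) hb (n+1))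
  refine ⟨⨆ n, x n, ?_, hlt 0, ?_⟩
  · apply lift_iSup_lt_of_lt_cof _ hx
    rw [← lift_cof]; simpa using h
  · intro y hy
    obtain ⟨n, hn⟩ := exists_lt_of_lt_ciSup hy
    exact ⟨x n, hlt n, hn, (hf n).trans (hlt (n+1))⟩

theorem club_unb_le {C : Set Ordinal.{u}} {δ : Ordinal.{u}} (hC : IsClubIn C δ) :
    ∃ n : Ordinal.{u} → Ordinal.{u}, ∀ x < δ, n x ∈ C ∧ x < n x ∧ n x < δ := by
  have : ∀ x, ∃ y, x < δ → y ∈ C ∧ x < y ∧ y < δ := by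
    intro x
    by_cases hx : x < δ
    · obtain ⟨y, hy, hxy⟩ := hC.2.1 x hx
      exact ⟨y, fun _ => ⟨hy, hxy, hC.1 y hy⟩⟩
    · exact ⟨0, fun h => absurd h hx⟩
  choose n hn using this
  exact ⟨n, hn⟩

theorem club_inter {δ η : Ordinal.{u}} (hω : ℵ₀ < δ.cof) (hη : η.card < δ.cof)
    (K : Ordinal.{u} → Set Ordinal.{u}) (hK : ∀ i < η, IsClubIn (K i) δ) :
    IsClubIn {x | x < δ ∧ ∀ i < η, x ∈ K i} δ := by
  refine ⟨fun x hx => hx.1, ?_, ?_⟩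
  · have : ∀ i, ∃ n : Ordinal.{u} → Ordinal.{u}, i < η → ∀ x < δ, n x ∈ K i ∧ x < n x ∧ n x < δ := by
      intro i
      by_cases hi : i < η
      · obtain ⟨n, hn⟩ := club_unb_le (hK i hi)
        exact ⟨n, fun _ => hn⟩
      · exact ⟨id, fun h => absurd h hi⟩
    choose n hn using this
    have hF : ∀ x, ∃ b, x < δ → b < δ ∧ ∀ i < η, n i x < b := by
      intro x
      by_cases hx : x < δ
      · obtain ⟨b, hb, h⟩ := bdd hη (fun i => n i x) (fun i hi => (hn i hi x hx).2.2)
        exact ⟨b, fun _ => ⟨hb, h⟩⟩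
      · exact ⟨0, fun h => absurd h hx⟩
    choose F hF using hF
    intro β hβ
    obtain ⟨α, hα, hβα, h⟩ := iter hω F (fun x hx => (hF x hx).1) hβ
    refine ⟨α, ⟨hα, fun i hi => ?_⟩, hβα⟩
    refine (hK i hi).2.2 α (lt_of_le_of_lt zero_le hβα) hα ?_
    intro x hx
    obtain ⟨y, hy, hxy, hFy⟩ := h x hx
    have h1 := hn i hi y (hy.trans hα)
    exact ⟨n i y, h1.1, hxy.trans h1.2.1, ((hF y (hy.trans hα)).2 i hi).trans hFy⟩
  · intro α h0 hα h
    refine ⟨hα, fun i hi => (hK i hi).2.2 α h0 hα fun β hβ => ?_⟩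
    obtain ⟨γ, hγ, h'⟩ := h β hβ
    exact ⟨γ, hγ.2 i hi, h'⟩

theorem club_inter2 {δ : Ordinal.{u}} (hω : ℵ₀ < δ.cof) {A B : Set Ordinal.{u}}
    (hA : IsClubIn A δ) (hB : IsClubIn B δ) : IsClubIn (A ∩ B) δ := by
  have := club_inter (η := 2) hω (by simpa using (nat_lt_aleph0 2).trans hω)
    (fun i => if i = 0 then A else B) (by intro i _; split_ifs <;> assumption)
  convert this using 1
  ext x
  constructor
  · rintro ⟨h1, h2⟩
    exact ⟨hA.1 x h1, fun i _ => by split_ifs <;> assumption⟩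
  · rintro ⟨_, h⟩
    have h0 := h 0 (by simp)
    have h1 := h 1 (by exact_mod_cast _root_.one_lt_two)
    simp at h0 h1
    exact ⟨h0, h1⟩

theorem club_Ioo {δ x : Ordinal.{u}} (hl : IsSuccLimit δ) (hx : x < δ) : IsClubIn {y | x < y ∧ y < δ} δ := by
  refine ⟨fun y hy => hy.2, fun β hβ => ⟨max x β + 1, ⟨?_, lim_succ hl (max_lt hx hβ)⟩, ?_⟩, ?_⟩
  · exact lt_of_le_of_lt (le_max_left _ _) (lt_add_one _)
  · exact lt_of_le_of_lt (le_max_right _ _) (lt_add_one _)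
  · intro α h0 hα h
    obtain ⟨γ, hγ, _, h2⟩ := h 0 h0
    exact ⟨hγ.1.trans h2, hα⟩

theorem club_univ {δ : Ordinal.{u}} (hl : IsSuccLimit δ) : IsClubIn {y | y < δ} δ :=
  ⟨fun y hy => hy, fun β hβ => ⟨β + 1, lim_succ hl hβ, lt_add_one _⟩, fun _ _ h _ => h⟩

theorem club_lim {δ : Ordinal.{u}} (hω : ℵ₀ < δ.cof) {C : Set Ordinal.{u}} (hC : IsClubIn C δ) :
    IsClubIn {y | y < δ ∧ IsSuccLimit y ∧ ∀ β < y, ∃ γ ∈ C, β < γ ∧ γ < y} δ := by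
  obtain ⟨n, hn⟩ := club_unb_le hC
  refine ⟨fun y hy => hy.1, ?_, ?_⟩
  · intro β hβ
    obtain ⟨α, hα, hβα, h⟩ := iter hω n (fun x hx => (hn x hx).2.2) hβ
    refine ⟨α, ⟨hα, ?_, ?_⟩, hβα⟩
    · refine lim_of (lt_of_le_of_lt zero_le hβα) fun b hb => ?_
      obtain ⟨y, hy, h1, _⟩ := h b hb
      exact ⟨y, hy, h1⟩
    · intro b hb
      obtain ⟨y, hy, h1, h2⟩ := h b hb
      have := hn y (hy.trans hα)
      exact ⟨n y, this.1, h1.trans this.2.1, h2⟩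
  · intro α h0 hα h
    refine ⟨hα, ?_, ?_⟩
    · refine lim_of h0 fun b hb => ?_
      obtain ⟨y, hy, h1, h2⟩ := h b hb
      exact ⟨y, h2, h1⟩
    · intro b hb
      obtain ⟨y, hy, h1, h2⟩ := h b hb
      obtain ⟨γ, hγ, h3, h4⟩ := hy.2.2 b h1
      exact ⟨γ, hγ, h3, h4.trans h2⟩

theorem club_diag {χ : Cardinal.{u}} (hχ : χ.IsRegular) (hω : ℵ₀ < χ)
    (K : Ordinal.{u} → Set Ordinal.{u}) (hK : ∀ i < χ.ord, IsClubIn (K i) χ.ord) :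
    IsClubIn {x | x < χ.ord ∧ IsSuccLimit x ∧ ∀ i < x, x ∈ K i} χ.ord := by
  have hc : χ.ord.cof = χ := hχ.cof_ord
  have hl : IsSuccLimit χ.ord := lim_cof (hc.symm ▸ hω.le)
  refine ⟨fun x hx => hx.1, ?_, ?_⟩
  · have : ∀ i, ∃ n : Ordinal.{u} → Ordinal.{u}, i < χ.ord →
        ∀ x < χ.ord, n x ∈ K i ∧ x < n x ∧ n x < χ.ord := by
      intro i
      by_cases hi : i < χ.ord
      · obtain ⟨n, hn⟩ := club_unb_le (hK i hi)
        exact ⟨n, fun _ => hn⟩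
      · exact ⟨id, fun h => absurd h hi⟩
    choose n hn using this
    have hF : ∀ x, ∃ b, x < χ.ord → b < χ.ord ∧ ∀ i < x, n i x < b := by
      intro x
      by_cases hx : x < χ.ord
      · obtain ⟨b, hb, h⟩ := bdd (δ := χ.ord) (η := x) (by rw [hc]; exact lt_ord.1 hx)
          (fun i => n i x) (fun i hi => (hn i (hi.trans hx) x hx).2.2)
        exact ⟨b, fun _ => ⟨hb, h⟩⟩
      · exact ⟨0, fun h => absurd h hx⟩
    choose F hF using hF
    intro β hβ
    obtain ⟨α, hα, hβα, h⟩ := iter (hc.symm ▸ hω) F (fun x hx => (hF x hx).1) hβ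
    refine ⟨α, ⟨hα, ?_, fun i hi => ?_⟩, hβα⟩
    · refine lim_of (lt_of_le_of_lt zero_le hβα) fun b hb => ?_
      obtain ⟨y, hy, h1, _⟩ := h b hb
      exact ⟨y, hy, h1⟩
    refine (hK i (hi.trans hα)).2.2 α (lt_of_le_of_lt zero_le hβα) hα ?_
    intro x hx
    obtain ⟨y, hy, hxy, hFy⟩ := h (max i x) (max_lt hi hx)
    have h1 := hn i (hi.trans hα) y (hy.trans hα)
    exact ⟨n i y, h1.1, (lt_of_le_of_lt (le_max_right _ _) hxy).trans h1.2.1,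
      ((hF y (hy.trans hα)).2 i (lt_of_le_of_lt (le_max_left _ _) hxy)).trans hFy⟩
  · intro α h0 hα h
    refine ⟨hα, ?_, fun i hi => (hK i (hi.trans hα)).2.2 α h0 hα fun β hβ => ?_⟩
    · refine lim_of h0 fun b hb => ?_
      obtain ⟨y, hy, h1, h2⟩ := h b hb
      exact ⟨y, h2, h1⟩
    obtain ⟨γ, hγ, h1, h2⟩ := h (max i β) (max_lt hi hβ)
    exact ⟨γ, hγ.2.2 i (lt_of_le_of_lt (le_max_left _ _) h1), lt_of_le_of_lt (le_max_right _ _) h1, h2⟩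

theorem club_cp {χ : Cardinal.{u}} (hχ : χ.IsRegular) (hω : ℵ₀ < χ)
    (φ : Ordinal.{u} → Ordinal.{u}) (hφ : ∀ i < χ.ord, φ i < χ.ord) :
    IsClubIn {x | x < χ.ord ∧ IsSuccLimit x ∧ ∀ i < x, φ i < x} χ.ord := by
  have hc : χ.ord.cof = χ := hχ.cof_ord
  have hl : IsSuccLimit χ.ord := lim_cof (hc.symm ▸ hω.le)
  have := club_diag hχ hω (fun i => {y | φ i < y ∧ y < χ.ord}) (fun i hi => club_Ioo hl (hφ i hi))
  convert this using 1
  ext x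
  constructor
  · rintro ⟨h1, h2, h3⟩
    exact ⟨h1, h2, fun i hi => ⟨h3 i hi, h1⟩⟩
  · rintro ⟨h1, h2, h3⟩
    exact ⟨h1, h2, fun i hi => (h3 i hi).1⟩
end WR

namespace WR
open Ordinal Cardinal Set Order
universe u

/-- normal (strictly increasing continuous) function on the ordinals below `η` -/
structure Nrm (e : Ordinal.{u} → Ordinal.{u}) (η : Ordinal.{u}) : Prop where
  mono : ∀ a b, a < b → b < η → e a < e b
  cont : ∀ a < η, IsSuccLimit a → ∀ x < e a, ∃ b < a, x < e b

/-- `e` maps `η` cofinally into `δ` -/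
structure CofF (e : Ordinal.{u} → Ordinal.{u}) (η δ : Ordinal.{u}) : Prop where
  lt : ∀ x < η, e x < δ
  cof : ∀ y < δ, ∃ x < η, y < e x

theorem Nrm.le {e η} (h : Nrm e η) {a b : Ordinal.{u}} (hab : a ≤ b) (hb : b < η) : e a ≤ e b := by
  rcases hab.eq_or_lt with rfl | h'
  · exact le_rfl
  · exact (h.mono a b h' hb).le

theorem Nrm.lt_iff {e η} (h : Nrm e η) {a b : Ordinal.{u}} (ha : a < η) (hb : b < η) :
    e a < e b ↔ a < b := by
  refine ⟨fun h' => ?_, fun h' => h.mono a b h' hb⟩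
  by_contra hn
  exact absurd h' (not_lt.2 (h.le (not_lt.1 hn) ha))

theorem Nrm.inj {e η} (h : Nrm e η) {a b : Ordinal.{u}} (ha : a < η) (hb : b < η) (hab : e a = e b) :
    a = b := by
  rcases lt_trichotomy a b with h' | h' | h'
  · exact absurd hab (h.mono a b h' hb).ne
  · exact h'
  · exact absurd hab (h.mono b a h' ha).ne'

theorem Nrm.ge {e η} (h : Nrm e η) (a : Ordinal.{u}) (ha : a < η) : a ≤ e a := by
  induction a using Ordinal.induction with
  | h a ih =>
    by_contra hn
    have h1 := not_le.1 hn
    exact absurd (ih _ h1 (h1.trans ha)) (not_le.2 (h.mono _ _ h1 ha))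

theorem Nrm.restr {e η} (h : Nrm e η) {η' : Ordinal.{u}} (hη : η' ≤ η) : Nrm e η' :=
  ⟨fun a b hab hb => h.mono a b hab (hb.trans_le hη), fun a ha => h.cont a (ha.trans_le hη)⟩

theorem Nrm.cofF {e η} (h : Nrm e η) {a : Ordinal.{u}} (ha : a < η) (hl : IsSuccLimit a) : CofF e a (e a) :=
  ⟨fun x hx => h.mono x a hx ha, h.cont a ha hl⟩

theorem cofF_pos {e} {η δ : Ordinal.{u}} (hc : CofF e η δ) (hl : IsSuccLimit η) : 0 < δ :=
  lt_of_le_of_lt zero_le (hc.lt 0 (lim_pos hl))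

theorem Nrm.cof_eq {e η} (h : Nrm e η) {δ : Ordinal.{u}} (hc : CofF e η δ) (hl : IsSuccLimit η) :
    δ.cof = η.cof := by
  have hs : StrictMono (fun x : Iio η => e x) := fun a b hab => h.mono a b hab b.2
  have := cof_iSup_Iio hs hl.isSuccPrelimit
  rw [← this]
  congr 1
  have : Nonempty (Iio η) := ⟨⟨0, lim_pos hl⟩⟩
  apply le_antisymm
  · by_contra hn
    obtain ⟨x, hx, h'⟩ := hc.cof _ (not_le.1 hn)
    exact absurd h' (not_lt.2 (le_ciSup (f := fun x : Iio η => e x)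
      ⟨δ, by rintro _ ⟨y, rfl⟩; exact (hc.lt _ y.2).le⟩ ⟨x, hx⟩))
  · exact ciSup_le fun x => (hc.lt _ x.2).le

theorem cofF_lim {e} {η δ : Ordinal.{u}} (h : Nrm e η) (hc : CofF e η δ) (hl : IsSuccLimit η) : IsSuccLimit δ := by
  refine lim_of (cofF_pos hc hl) fun b hb => ?_
  obtain ⟨x, hx, h'⟩ := hc.cof b hb
  exact ⟨e x, hc.lt x hx, h'⟩

/-- key: limits of points in the range of `e` below `δ` are in range of `e` at a limit -/
theorem Nrm.lim_range {e η} (h : Nrm e η) {δ : Ordinal.{u}} (hc : CofF e η δ) {α : Ordinal.{u}}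
    (h0 : 0 < α) (hα : α < δ) (hh : ∀ β < α, ∃ x < η, β < e x ∧ e x < α) :
    ∃ a < η, IsSuccLimit a ∧ α = e a ∧ CofF e a α := by
  obtain ⟨x, hx, hxα⟩ := hc.cof α hα
  let a := sInf {x | α ≤ e x}
  have ha : α ≤ e a := csInf_mem (s := {x | α ≤ e x}) ⟨x, hxα.le⟩
  have hax : a ≤ x := csInf_le' (s := {x | α ≤ e x}) hxα.le
  have haη := hax.trans_lt hx
  have hlt : ∀ y < a, e y < α := fun y hy => not_le.1 fun h' => absurd (csInf_le' (s := {x | α ≤ e x}) h') (not_le.2 hy)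
  have hl : IsSuccLimit a := by
    refine lim_of ?_ ?_
    · obtain ⟨y, hy, _, h2⟩ := hh 0 h0
      refine lt_of_le_of_lt zero_le ((h.lt_iff hy haη).1 (h2.trans_le ha))
    · intro b hb
      obtain ⟨y, hy, h1, h2⟩ := hh _ (hlt b hb)
      exact ⟨y, (h.lt_iff hy haη).1 (h2.trans_le ha), (h.lt_iff (hb.trans haη) hy).1 h1⟩
  have hae : α = e a := by
    apply le_antisymm ha
    by_contra hn
    obtain ⟨b, hb, h'⟩ := h.cont a haη hl α (not_le.1 hn)
    exact absurd h' (not_lt.2 (hlt b hb).le)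
  exact ⟨a, haη, hl, hae, hae ▸ h.cofF haη hl⟩

theorem Nrm.image_club {e η} (h : Nrm e η) {δ : Ordinal.{u}} (hc : CofF e η δ) {C : Set Ordinal.{u}}
    (hC : IsClubIn C η) : IsClubIn (e '' C) δ := by
  refine ⟨?_, ?_, ?_⟩
  · rintro _ ⟨x, hx, rfl⟩
    exact hc.lt x (hC.1 x hx)
  · intro β hβ
    obtain ⟨x, hx, h1⟩ := hc.cof β hβ
    obtain ⟨y, hy, h2⟩ := hC.2.1 x hx
    exact ⟨e y, ⟨y, hy, rfl⟩, h1.trans (h.mono x y h2 (hC.1 y hy))⟩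
  · intro α h0 hα hh
    obtain ⟨a, ha, hl, rfl, hca⟩ := h.lim_range hc h0 hα (fun β hβ => by
      obtain ⟨_, ⟨x, hx, rfl⟩, h1⟩ := hh β hβ
      exact ⟨x, hC.1 x hx, h1⟩)
    refine ⟨a, hC.2.2 a (lim_pos hl) ha ?_, rfl⟩
    intro b hb
    obtain ⟨_, ⟨x, hx, rfl⟩, h1, h2⟩ := hh (e b) (hca.lt b hb)
    exact ⟨x, hx, (h.lt_iff (hb.trans ha) (hC.1 x hx)).1 h1, (h.lt_iff (hC.1 x hx) ha).1 h2⟩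

theorem Nrm.range_club {e η} (h : Nrm e η) {δ : Ordinal.{u}} (hc : CofF e η δ) (hl : IsSuccLimit η) :
    IsClubIn (e '' {x | x < η}) δ := h.image_club hc (club_univ hl)

theorem Nrm.preimage_club {e η} (h : Nrm e η) {δ : Ordinal.{u}} (hc : CofF e η δ) (hω : ℵ₀ < η.cof)
    {C : Set Ordinal.{u}} (hC : IsClubIn C δ) : IsClubIn {x | x < η ∧ e x ∈ C} η := by
  have hl := lim_cof hω.le
  have hωδ : ℵ₀ < δ.cof := by rw [h.cof_eq hc hl]; exact hω
  have hI := club_inter2 hωδ hC (h.range_club hc hl)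
  refine ⟨fun x hx => hx.1, ?_, ?_⟩
  · intro β hβ
    obtain ⟨_, ⟨h1, ⟨x, hx, rfl⟩⟩, h3⟩ := hI.2.1 (e β) (hc.lt β hβ)
    exact ⟨x, ⟨hx, h1⟩, (h.lt_iff hβ hx).1 h3⟩
  · intro a h0 ha hh
    have hla : IsSuccLimit a := lim_of h0 fun b hb => by
      obtain ⟨y, _, h1, h2⟩ := hh b hb
      exact ⟨y, h2, h1⟩
    refine ⟨ha, hC.2.2 (e a) ?_ (hc.lt a ha) ?_⟩
    · exact lt_of_le_of_lt zero_le (h.mono 0 a h0 ha)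
    · intro β hβ
      obtain ⟨b, hb, h1⟩ := h.cont a ha hla β hβ
      obtain ⟨y, hy, h2, h3⟩ := hh b hb
      exact ⟨e y, hy.2, h1.trans (h.mono _ _ h2 hy.1), h.mono _ _ h3 ha⟩

theorem Nrm.agree {e e' η} (h : Nrm e η) (h' : Nrm e' η) {δ : Ordinal.{u}} (hc : CofF e η δ) (hc' : CofF e' η δ)
    (hω : ℵ₀ < η.cof) : IsClubIn {x | x < η ∧ e x = e' x} η := by
  have hl := lim_cof hω.le
  refine ⟨fun x hx => hx.1, ?_, ?_⟩
  · have : ∀ y, ∃ z, y < η → z < η ∧ e y < e' z ∧ e' y < e z := by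
      intro y
      by_cases hy : y < η
      · obtain ⟨z, hz, h1⟩ := hc'.cof _ (hc.lt y hy)
        obtain ⟨w, hw, h2⟩ := hc.cof _ (hc'.lt y hy)
        have hm := max_lt hz hw
        exact ⟨max z w, fun _ => ⟨hm, h1.trans_le (h'.le (le_max_left _ _) hm),
          h2.trans_le (h.le (le_max_right _ _) hm)⟩⟩
      · exact ⟨0, fun h => absurd h hy⟩
    choose F hF using this
    intro β hβ
    obtain ⟨α, hα, hβα, hh⟩ := iter hω F (fun x hx => (hF x hx).1) hβ
    have hla : IsSuccLimit α := lim_of (lt_of_le_of_lt zero_le hβα) fun b hb => by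
      obtain ⟨y, hy, h1, h2⟩ := hh b hb
      exact ⟨y, hy, h1⟩
    refine ⟨α, ⟨hα, ?_⟩, hβα⟩
    apply le_antisymm
    · by_contra hn
      obtain ⟨b, hb, h1⟩ := h.cont α hα hla _ (not_le.1 hn)
      obtain ⟨y, hy, h2, h3⟩ := hh b hb
      have h4 := hF y (hy.trans hα)
      exact lt_irrefl _ ((((h1.trans (h.mono _ _ h2 (hy.trans hα))).trans h4.2.1)).trans (h'.mono _ _ h3 hα))
    · by_contra hn
      obtain ⟨b, hb, h1⟩ := h'.cont α hα hla _ (not_le.1 hn)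
      obtain ⟨y, hy, h2, h3⟩ := hh b hb
      have h4 := hF y (hy.trans hα)
      exact lt_irrefl _ ((((h1.trans (h'.mono _ _ h2 (hy.trans hα))).trans h4.2.2)).trans (h.mono _ _ h3 hα))
  · intro a h0 ha hh
    have hla : IsSuccLimit a := lim_of h0 fun b hb => by
      obtain ⟨y, _, h1, h2⟩ := hh b hb
      exact ⟨y, h2, h1⟩
    refine ⟨ha, ?_⟩
    apply le_antisymm
    · by_contra hn
      obtain ⟨b, hb, h1⟩ := h.cont a ha hla _ (not_le.1 hn)
      obtain ⟨y, hy, h2, h3⟩ := hh b hb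
      have := h1.trans (h.mono _ _ h2 hy.1)
      rw [hy.2] at this
      exact lt_irrefl _ (this.trans (h'.mono _ _ h3 ha))
    · by_contra hn
      obtain ⟨b, hb, h1⟩ := h'.cont a ha hla _ (not_le.1 hn)
      obtain ⟨y, hy, h2, h3⟩ := hh b hb
      have := h1.trans (h'.mono _ _ h2 hy.1)
      rw [← hy.2] at this
      exact lt_irrefl _ (this.trans (h.mono _ _ h3 ha))

/-- truncation -/
noncomputable def tr (e : Ordinal.{u} → Ordinal.{u}) (k : Ordinal.{u}) : Ordinal.{u} → Ordinal.{u} := by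
  classical exact fun x => if x ≤ k then e x else 0

theorem tr_le {e : Ordinal.{u} → Ordinal.{u}} {k x : Ordinal.{u}} (h : x ≤ k) : tr e k x = e x := by
  unfold tr; rw [if_pos h]

open Classical in
noncomputable def recE (C : Set Ordinal.{u}) (Φ : (Ordinal.{u} → Ordinal.{u}) → Ordinal.{u} → Ordinal.{u})
    (ε : Ordinal.{u}) : Ordinal.{u} :=
  sInf {x | x ∈ C ∧ ∀ ε', ∀ h : ε' < ε, recE C Φ ε' < x ∧
    Φ (fun y => if h' : y ≤ ε' then recE C Φ y else 0) ε' < x}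
termination_by ε
decreasing_by
  · exact h
  · exact lt_of_le_of_lt h' h

theorem recE_eq (C : Set Ordinal.{u}) (Φ : (Ordinal.{u} → Ordinal.{u}) → Ordinal.{u} → Ordinal.{u})
    (ε : Ordinal.{u}) : recE C Φ ε = sInf {x | x ∈ C ∧ ∀ ε' < ε, recE C Φ ε' < x ∧
    Φ (tr (recE C Φ) ε') ε' < x} := by
  rw [recE]; rfl

theorem rec_lemma {χ : Cardinal.{u}} (hχ : χ.IsRegular) {δ : Ordinal.{u}} (hδ : χ ≤ δ.cof)
    {C : Set Ordinal.{u}} (hC : IsClubIn C δ)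
    (Φ : (Ordinal.{u} → Ordinal.{u}) → Ordinal.{u} → Ordinal.{u})
    (hΦ : ∀ d k, k < χ.ord → (∀ x, d x < δ) → Φ d k < δ) :
    ∃ e, Nrm e χ.ord ∧ (∀ k < χ.ord, e k ∈ C) ∧ ∀ k < χ.ord, Φ (tr e k) k < e (k + 1) := by
  set e := recE C Φ with he
  have hlχ : IsSuccLimit χ.ord := lim_cof (hχ.cof_ord.symm ▸ hχ.aleph0_le)
  have hδ0 : 0 < δ := by
    rw [← cof_pos]; exact lt_of_lt_of_le hχ.pos hδ
  have key : ∀ ε < χ.ord, e ε ∈ {x | x ∈ C ∧ ∀ ε' < ε, e ε' < x ∧ Φ (tr e ε') ε' < x} := by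
    intro ε
    induction ε using Ordinal.induction with
    | h ε ih =>
      intro hε
      have hv : ∀ ε' < ε, max (e ε') (Φ (tr e ε') ε') < δ := by
        intro ε' hε'
        refine max_lt (hC.1 _ (ih ε' hε' (hε'.trans hε)).1) (hΦ _ _ (hε'.trans hε) ?_)
        intro x
        unfold tr
        split_ifs with hx
        · exact hC.1 _ (ih x (hx.trans_lt hε') ((hx.trans_lt hε').trans hε)).1
        · exact hδ0
      obtain ⟨b, hb, hb'⟩ := bdd (lt_of_lt_of_le (lt_ord.1 hε) hδ) _ hv
      obtain ⟨y, hy, hby⟩ := hC.2.1 b hb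
      rw [he, recE_eq, ← he]
      apply csInf_mem
      exact ⟨y, hy, fun ε' hε' => ⟨(le_max_left _ _).trans_lt ((hb' ε' hε').trans hby),
        (le_max_right _ _).trans_lt ((hb' ε' hε').trans hby)⟩⟩
  have hmono : ∀ a b, a < b → b < χ.ord → e a < e b := fun a b hab hb => ((key b hb).2 a hab).1
  refine ⟨e, ⟨hmono, ?_⟩, fun k hk => (key k hk).1, fun k hk => ((key (k+1) (lim_succ hlχ hk)).2 k (lt_add_one k)).2⟩
  intro ε hε hl x hx
  by_contra hn
  push Not at hn
  let s := sInf {y | ∀ b < ε, e b < y}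
  have hs : ∀ b < ε, e b < s := by
    apply csInf_mem (s := {y | ∀ b < ε, e b < y})
    exact ⟨e ε, fun b hb => hmono b ε hb hε⟩
  have hsx : s ≤ x := by
    apply csInf_le' (s := {y | ∀ b < ε, e b < y})
    intro b hb
    exact (hmono b (b+1) (lt_add_one b) ((lim_succ hl hb).trans hε)).trans_le (hn _ (lim_succ hl hb))
  have hsC : s ∈ C := by
    refine hC.2.2 s (lt_of_le_of_lt zero_le (hs 0 (lim_pos hl))) ((hsx.trans_lt hx).trans (hC.1 _ (key ε hε).1)) ?_
    intro β hβ
    by_contra hn'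
    push Not at hn'
    have : s ≤ β := by
      apply csInf_le' (s := {y | ∀ b < ε, e b < y})
      intro b hb
      by_contra h3
      have h4 := hmono b (b+1) (lt_add_one b) ((lim_succ hl hb).trans hε)
      have := hn' (e (b+1)) (key _ ((lim_succ hl hb).trans hε)).1 ((not_lt.1 h3).trans_lt h4)
      exact absurd (hs _ (lim_succ hl hb)) (not_lt.2 this)
    exact absurd hβ (not_lt.2 this)
  have : e ε ≤ s := by
    rw [he, recE_eq, ← he]
    apply csInf_le'
    refine ⟨hsC, fun ε' hε' => ⟨hs ε' hε', ?_⟩⟩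
    exact ((key (ε'+1) ((lim_succ hl hε').trans hε)).2 ε' (lt_add_one ε')).2.trans (hs _ (lim_succ hl hε'))
  exact absurd hx (not_lt.2 (this.trans hsx))

theorem exists_cofinal (δ : Ordinal.{u}) : ∃ g : Ordinal.{u} → Ordinal.{u},
    (∀ x < δ.cof.ord, g x < δ) ∧ ∀ y < δ, ∃ x < δ.cof.ord, y ≤ g x := by
  classical
  obtain ⟨f, hf⟩ := exists_blsub_cof δ
  refine ⟨fun x => if h : x < δ.cof.ord then f x h else 0, fun x hx => ?_, fun y hy => ?_⟩
  · have := lt_blsub f x hx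
    rw [hf] at this
    simpa [hx] using this
  · rw [← hf, lt_blsub_iff] at hy
    obtain ⟨x, hx, h⟩ := hy
    exact ⟨x, hx, by simpa [hx] using h⟩

theorem NE {δ : Ordinal.{u}} (hl : IsSuccLimit δ) {χ : Cardinal.{u}} (hχ : δ.cof = χ) {C : Set Ordinal.{u}}
    (hC : IsClubIn C δ) : ∃ e, Nrm e χ.ord ∧ CofF e χ.ord δ ∧ ∀ k < χ.ord, e k ∈ C := by
  subst hχ
  obtain ⟨g, hg, hg'⟩ := exists_cofinal δ
  have hr : δ.cof.IsRegular := isRegular_cof hl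
  obtain ⟨e, h1, h2, h3⟩ := rec_lemma hr le_rfl hC (fun _ k => g k) (fun _ k hk _ => hg k hk)
  have hlχ : IsSuccLimit δ.cof.ord := lim_cof (hr.cof_ord.symm ▸ hr.aleph0_le)
  refine ⟨e, h1, ⟨fun k hk => hC.1 _ (h2 k hk), fun y hy => ?_⟩, h2⟩
  obtain ⟨x, hx, hyx⟩ := hg' y hy
  exact ⟨x + 1, lim_succ hlχ hx, hyx.trans_lt (h3 x hx)⟩
end WR

namespace WR
open Ordinal Cardinal Set Order
universe u

theorem snr_triv {κ χ : Cardinal.{u}} (h0 : 0 < κ) (h : χ ≤ κ) : SNR χ.ord κ := by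
  refine ⟨fun _ => 0, fun _ _ => ?_, ?_⟩
  · rw [lt_ord]; simpa using h0
  · rintro δ ⟨h1, h2⟩
    have := (cof_le_card δ).trans_lt (lt_ord.1 h1)
    rw [h2] at this
    exact absurd h (not_le.2 this)

theorem notSNR {κ : Cardinal.{u}} (hκ : κ.IsRegular) (hω : ℵ₀ < κ) {η : Ordinal.{u}} (hn : ¬ SNR η κ)
    (h : Ordinal.{u} → Ordinal.{u}) (hh : ∀ α < η, h α < κ.ord) :
    ∃ δ ∈ Sset η κ, ∃ i < κ.ord, ∀ K, IsClubIn K δ → ∃ ζ ∈ K, h ζ ≤ i := by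
  by_contra hcon
  push Not at hcon
  apply hn
  refine ⟨h, hh, fun δ hδ => ?_⟩
  have hl : IsSuccLimit δ := lim_cof (hδ.2 ▸ hω.le)
  obtain ⟨e, he, hc, -⟩ := NE hl hδ.2 (club_univ hl)
  have : ∀ i, ∃ K, i < κ.ord → IsClubIn K δ ∧ ∀ ζ ∈ K, i < h ζ := by
    intro i
    by_cases hi : i < κ.ord
    · obtain ⟨K, hK⟩ := hcon δ hδ i hi
      exact ⟨K, fun _ => hK⟩
    · exact ⟨∅, fun h => absurd h hi⟩
  choose K hK using this
  have hωκ : ℵ₀ < κ.ord.cof := by rw [hκ.cof_ord]; exact hω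
  have hD := club_diag hκ hω (fun i => {x | x < κ.ord ∧ e x ∈ K i})
    (fun i hi => he.preimage_club hc hωκ (hK i hi).1)
  have hP := club_cp hκ hω (fun x => h (e x)) (fun x hx => hh _ ((hc.lt x hx).trans hδ.1))
  refine ⟨_, he.image_club hc (club_inter2 hωκ hD hP), ?_⟩
  rintro _ ⟨a, ha, rfl⟩ _ ⟨b, hb, rfl⟩ hab
  have hab' := (he.lt_iff ha.1.1 hb.1.1).1 hab
  have h1 := hb.2.2.2 a hab'
  exact (hK _ (h1.trans hb.1.1)).2 _ (hb.1.2.2 _ h1).2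

theorem snr_glue {κ χ : Cardinal.{u}} (hω : ℵ₀ < κ) {η : Ordinal.{u}} (hl : IsSuccLimit η)
    {c : Ordinal.{u} → Ordinal.{u}} (hc : Nrm c χ.ord) (hcc : CofF c χ.ord η)
    (hprev : ∀ η' < η, SNR η' κ) (g : Ordinal.{u} → Ordinal.{u}) (hg : ∀ i < χ.ord, g i < κ.ord)
    (hg2 : ∀ δ ∈ Sset χ.ord κ, ∃ C, IsClubIn C δ ∧ StrictMonoOn g C) :
    ∃ h : Ordinal.{u} → Ordinal.{u}, (∀ α < η, h α < κ.ord) ∧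
      (∀ δ ∈ Sset η κ, ∃ C, IsClubIn C δ ∧ StrictMonoOn h C) ∧ ∀ i < χ.ord, h (c i) = g i := by
  classical
  have : ∀ η', ∃ h : Ordinal.{u} → Ordinal.{u}, η' < η → (∀ α < η', h α < κ.ord) ∧
      (∀ δ ∈ Sset η' κ, ∃ C, IsClubIn C δ ∧ StrictMonoOn h C) := by
    intro η'
    by_cases h : η' < η
    · obtain ⟨h', hh⟩ := hprev η' h
      exact ⟨h', fun _ => hh⟩
    · exact ⟨id, fun h' => absurd h' h⟩
  choose w hw using this
  let j : Ordinal.{u} → Ordinal.{u} := fun x => sInf {i | x < c i}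
  have hj : ∀ x < η, j x < χ.ord ∧ x < c (j x) := by
    intro x hx
    obtain ⟨i, hi, h1⟩ := hcc.cof x hx
    exact ⟨(csInf_le' (s := {i | x < c i}) h1).trans_lt hi, csInf_mem (s := {i | x < c i}) ⟨i, h1⟩⟩
  let h : Ordinal.{u} → Ordinal.{u} := fun x =>
    if hx : ∃ i, i < χ.ord ∧ c i = x then g hx.choose else w (c (j x) + 1) x
  have hr : ∀ i < χ.ord, h (c i) = g i := by
    intro i hi
    have hx : ∃ i', i' < χ.ord ∧ c i' = c i := ⟨i, hi, rfl⟩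
    have : h (c i) = g hx.choose := dif_pos hx
    rw [this, hc.inj hx.choose_spec.1 hi hx.choose_spec.2]
  have hnr : ∀ x, (¬ ∃ i, i < χ.ord ∧ c i = x) → h x = w (c (j x) + 1) x := fun x hx => dif_neg hx
  refine ⟨h, ?_, ?_, hr⟩
  · intro x hx
    by_cases hx' : ∃ i, i < χ.ord ∧ c i = x
    · obtain ⟨i, hi, rfl⟩ := hx'
      rw [hr i hi]; exact hg i hi
    · rw [hnr x hx']
      obtain ⟨h1, h2⟩ := hj x hx
      exact (hw _ (lim_succ hl (hcc.lt _ h1))).1 x (h2.trans (lt_add_one _))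
  · rintro δ ⟨hδ, hδc⟩
    have hlδ : IsSuccLimit δ := lim_cof (hδc ▸ hω.le)
    by_cases hcase : ∀ β < δ, ∃ x < χ.ord, β < c x ∧ c x < δ
    · obtain ⟨a, ha, hla, rfl, hca⟩ := hc.lim_range hcc (lim_pos hlδ) hδ hcase
      have hcof := (hc.restr ha.le).cof_eq hca hla
      obtain ⟨C, hC, hm⟩ := hg2 a ⟨ha, hcof ▸ hδc⟩
      refine ⟨_, (hc.restr ha.le).image_club hca hC, ?_⟩
      rintro _ ⟨x, hx, rfl⟩ _ ⟨y, hy, rfl⟩ hxy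
      have hx' := (hC.1 x hx).trans ha
      have hy' := (hC.1 y hy).trans ha
      rw [hr x hx', hr y hy']
      exact hm hx hy ((hc.lt_iff hx' hy').1 hxy)
    · push Not at hcase
      obtain ⟨β, hβ, hcase⟩ := hcase
      obtain ⟨i, hi, h1⟩ := hcc.cof δ hδ
      let J := sInf {i | δ ≤ c i}
      have hJ : δ ≤ c J := csInf_mem (s := {i | δ ≤ c i}) ⟨i, h1.le⟩
      have hJχ : J < χ.ord := (csInf_le' (s := {i | δ ≤ c i}) h1.le).trans_lt hi
      have hJ2 : ∀ i < J, c i < δ := fun i hi => not_le.1 fun h' =>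
        absurd (csInf_le' (s := {i | δ ≤ c i}) h') (not_le.2 hi)
      have hjJ : ∀ y, β < y → y < δ → j y = J ∧ ¬ ∃ i, i < χ.ord ∧ c i = y := by
        intro y hy hyδ
        constructor
        · apply le_antisymm
          · exact csInf_le' (s := {i | y < c i}) (hyδ.trans_le hJ)
          · by_contra hn
            have h2 := hJ2 _ (not_le.1 hn)
            obtain ⟨h3, h4⟩ := hj y (hyδ.trans hδ)
            have := hcase _ h3 (hy.trans h4)
            exact absurd h2 (not_lt.2 this)
        · rintro ⟨i, hi, rfl⟩
          exact absurd hyδ (not_lt.2 (hcase i hi hy))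
      obtain ⟨C, hC, hm⟩ := (hw _ (lim_succ hl (hcc.lt _ hJχ))).2 δ ⟨hJ.trans_lt (lt_add_one _), hδc⟩
      refine ⟨_, club_inter2 (hδc ▸ hω) hC (club_Ioo hlδ hβ), ?_⟩
      have hval : ∀ y, β < y → y < δ → h y = w (c J + 1) y := by
        intro y h1 h2
        obtain ⟨h3, h4⟩ := hjJ y h1 h2
        rw [hnr y h4, h3]
      intro x hx y hy hxy
      rw [hval x hx.2.1 hx.2.2, hval y hy.2.1 hy.2.2]
      exact hm hx.1 hy.1 hxy

theorem snr_all {μ κ : Cardinal.{u}} (hω : ℵ₀ < κ) (hκμ : κ < μ) (hcof : μ.ord.cof = κ)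
    (hreg : ∀ χ : Cardinal.{u}, χ.IsRegular → κ < χ → χ < μ → SNR χ.ord κ) :
    ∀ η < (succ μ).ord, SNR η κ := by
  classical
  have hκ0 : 0 < κ.ord := by rw [lt_ord]; simpa using aleph0_pos.trans hω
  have hreg' : ∀ χ : Cardinal.{u}, χ.IsRegular → χ < μ → SNR χ.ord κ := by
    intro χ h1 h2
    rcases le_or_gt χ κ with h | h
    · exact snr_triv (aleph0_pos.trans hω) h
    · exact hreg χ h1 h h2
  intro η
  induction η using Ordinal.induction with
  | h η ih =>
    intro hη
    rcases cases3 η with rfl | ⟨α, rfl⟩ | hl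
    · exact ⟨fun _ => 0, fun _ _ => hκ0, fun δ hδ => absurd hδ.1 (not_lt.2 zero_le)⟩
    · have hα : α < (succ μ).ord := (lt_add_one α).trans hη
      suffices H : ∃ h : Ordinal.{u} → Ordinal.{u}, (∀ x < α, h x < κ.ord) ∧
          ∀ δ ∈ Sset (α+1) κ, ∃ C, IsClubIn C δ ∧ StrictMonoOn h C by
        obtain ⟨h, h1, h2⟩ := H
        refine ⟨fun x => if x < α then h x else 0, fun x hx => ?_, fun δ hδ => ?_⟩
        · dsimp only
          split_ifs with hh
          · exact h1 x hh
          · exact hκ0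
        · obtain ⟨C, hC, hm⟩ := h2 δ hδ
          refine ⟨C, hC, ?_⟩
          have hlt : ∀ x ∈ C, x < α := fun x hx => (hC.1 x hx).trans_le (lt_add_one_iff.1 hδ.1)
          intro x hx y hy hxy
          simp only [hlt x hx, hlt y hy, if_true]
          exact hm hx hy hxy
      by_cases hc : α.cof = κ
      · have hl : IsSuccLimit α := lim_cof (hc ▸ hω.le)
        obtain ⟨c, h1, h2, -⟩ := NE hl hc (club_univ hl)
        have hrk : κ.IsRegular := hc ▸ isRegular_cof hl
        obtain ⟨h, h3, h4, h5⟩ := snr_glue hω hl h1 h2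
          (fun η' h' => ih η' (h'.trans (lt_add_one α)) (h'.trans hα)) id (fun i hi => hi) (by
            rintro δ ⟨h1, h2⟩
            have := (cof_le_card δ).trans_lt (lt_ord.1 h1)
            rw [h2] at this
            exact absurd this (lt_irrefl _))
        refine ⟨h, h3, fun δ hδ => ?_⟩
        rcases (lt_add_one_iff.1 hδ.1).eq_or_lt with rfl | hlt
        · refine ⟨_, h1.range_club h2 (lim_cof (hrk.cof_ord.symm ▸ hω.le)), ?_⟩
          rintro _ ⟨x, hx, rfl⟩ _ ⟨y, hy, rfl⟩ hxy
          rw [h5 x hx, h5 y hy]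
          exact (h1.lt_iff hx hy).1 hxy
        · exact h4 δ ⟨hlt, hδ.2⟩
      · obtain ⟨h, h1, h2⟩ := ih α (lt_add_one α) hα
        refine ⟨h, h1, fun δ hδ => ?_⟩
        rcases (lt_add_one_iff.1 hδ.1).eq_or_lt with rfl | hlt
        · exact absurd hδ.2 hc
        · exact h2 δ ⟨hlt, hδ.2⟩
    · have hr : η.cof.IsRegular := isRegular_cof hl
      have hle : η.cof ≤ μ := (cof_le_card η).trans (lt_succ_iff.1 (lt_ord.1 hη))
      have hlt : η.cof < μ := by
        refine lt_of_le_of_ne hle fun h => ?_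
        rw [h] at hr
        have := hr.cof_ord
        rw [hcof] at this
        exact hκμ.ne this
      obtain ⟨c, h1, h2, -⟩ := NE hl rfl (club_univ hl)
      obtain ⟨g, hg, hg2⟩ := hreg' _ hr hlt
      obtain ⟨h, h3, h4, -⟩ := snr_glue hω hl h1 h2 (fun η' h' => ih η' h' (h'.trans hη)) g hg hg2
      exact ⟨h, h3, h4⟩
end WR

namespace WR
open Ordinal Cardinal Set Order
universe u

theorem no_inj {a b : Cardinal.{u}} (h : a < b) (f : Ordinal.{u} → Ordinal.{u})
    (hf : ∀ x < b.ord, f x < a.ord) (hinj : ∀ x y, x < y → y < b.ord → f x ≠ f y) : False := by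
  have : #(Iio b.ord) ≤ #(Iio a.ord) := by
    refine mk_le_of_injective (f := fun x : Iio b.ord => (⟨f x, hf x x.2⟩ : Iio a.ord)) ?_
    intro x y hxy
    have hxy' : f x = f y := congrArg Subtype.val hxy
    rcases lt_trichotomy x.1 y.1 with h | h | h
    · exact absurd hxy' (hinj _ _ h y.2)
    · exact Subtype.ext h
    · exact absurd hxy'.symm (hinj _ _ h x.2)
  rw [Cardinal.mk_Iio_ordinal, Cardinal.mk_Iio_ordinal, card_ord, card_ord, Cardinal.lift_le] at this
  exact absurd h (not_lt.2 this)

theorem exists_sup {η δ : Ordinal.{u}} {d : Ordinal.{u} → Ordinal.{u}} (hd : Nrm d η) (hl : IsSuccLimit η)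
    (hη : η.card < δ.cof) (h : ∀ x < η, d x < δ) : ∃ α < δ, CofF d η α := by
  obtain ⟨b, hb, hb'⟩ := bdd hη d h
  refine ⟨sInf {y | ∀ x < η, d x < y}, ?_, ?_, ?_⟩
  · exact (csInf_le' (s := {y | ∀ x < η, d x < y}) hb').trans_lt hb
  · exact csInf_mem (s := {y | ∀ x < η, d x < y}) ⟨b, hb'⟩
  · intro y hy
    by_contra hn
    push Not at hn
    refine absurd hy (not_lt.2 (csInf_le' (s := {y | ∀ x < η, d x < y}) ?_))
    intro x hx
    exact (hd.mono x _ (lt_add_one x) (lim_succ hl hx)).trans_le (hn _ (lim_succ hl hx))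

theorem club_restr {E : Set Ordinal.{u}} {δ i : Ordinal.{u}} (hE : IsClubIn E δ) (hi : i < δ)
    (hacc : ∀ β < i, ∃ γ ∈ E, β < γ ∧ γ < i) : IsClubIn {x | x ∈ E ∧ x < i} i := by
  refine ⟨fun x hx => hx.2, fun β hβ => ?_, fun α h0 hα h => ⟨hE.2.2 α h0 (hα.trans hi) ?_, hα⟩⟩
  · obtain ⟨γ, h1, h2, h3⟩ := hacc β hβ
    exact ⟨γ, ⟨h1, h3⟩, h2⟩
  · intro β hβ
    obtain ⟨γ, h1, h2⟩ := h β hβ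
    exact ⟨γ, h1.1, h2⟩

def cgE (n : Set Ordinal.{u} → Set Ordinal.{u}) (s : Ordinal.{u}) (ν : Ordinal.{u}) : Set Ordinal.{u} :=
  {x | x < s ∧ ∀ ν', ∀ _h : ν' < ν, x ∈ cgE n s ν' ∩ n (cgE n s ν')}
termination_by ν

theorem cg_exists {θ : Cardinal.{u}} (hθ : θ.IsRegular) {σ : Cardinal.{u}} (hσ : σ = succ (succ θ))
    (b : Ordinal.{u} → Ordinal.{u} → Ordinal.{u}) :
    ∃ E, IsClubIn E σ.ord ∧ ∀ D, IsClubIn D σ.ord → ∃ i ∈ Sset σ.ord θ,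
      (∀ β < i, ∃ γ ∈ E, β < γ ∧ γ < i) ∧ (b i '' {x | x < θ.ord}) ∩ E ⊆ D := by
  by_contra hcon
  push Not at hcon
  have : ∀ E, ∃ D, IsClubIn E σ.ord → IsClubIn D σ.ord ∧ ∀ i ∈ Sset σ.ord θ,
      (∀ β < i, ∃ γ ∈ E, β < γ ∧ γ < i) → ¬ (b i '' {x | x < θ.ord}) ∩ E ⊆ D := by
    intro E
    by_cases hE : IsClubIn E σ.ord
    · obtain ⟨D, hD⟩ := hcon E hE
      exact ⟨D, fun _ => hD⟩
    · exact ⟨∅, fun h => absurd h hE⟩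
  choose n hn using this
  have hθs : θ < succ θ := lt_succ θ
  have hsσ : succ θ < σ := hσ ▸ lt_succ _
  have hσr : σ.IsRegular := hσ ▸ isRegular_succ (hθ.aleph0_le.trans hθs.le)
  have hωσ : ℵ₀ < σ := (hθ.aleph0_le.trans_lt hθs).trans hsσ
  have hcσ : σ.ord.cof = σ := hσr.cof_ord
  have hE : ∀ ν < (succ θ).ord, IsClubIn (cgE n σ.ord ν) σ.ord := by
    intro ν
    induction ν using Ordinal.induction with
    | h ν ih =>
      intro hν
      have := club_inter (δ := σ.ord) (η := ν) (hcσ.symm ▸ hωσ) (by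
        rw [hcσ]; exact (lt_ord.1 hν).trans hsσ) (fun ν' => cgE n σ.ord ν' ∩ n (cgE n σ.ord ν'))
        (fun ν' hν' => club_inter2 (hcσ.symm ▸ hωσ) (ih ν' hν' (hν'.trans hν)) (hn _ (ih ν' hν' (hν'.trans hν))).1)
      rw [cgE]
      exact this
  have hEs := club_inter (δ := σ.ord) (η := (succ θ).ord) (hcσ.symm ▸ hωσ) (by
        rw [hcσ, card_ord]; exact hsσ) (fun ν' => cgE n σ.ord ν') hE
  obtain ⟨e, he, heE, -⟩ := rec_lemma hσr (hcσ.symm ▸ le_rfl) hEs (fun _ _ => 0) (fun _ _ _ _ => by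
    rw [lt_ord]; simpa using aleph0_pos.trans hωσ)
  have hlθ : IsSuccLimit θ.ord := lim_cof (hθ.cof_ord.symm ▸ hθ.aleph0_le)
  have hθσ : θ.ord < σ.ord := ord_lt_ord.2 (hθs.trans hsσ)
  have hcf := he.cofF hθσ hlθ
  have hi : e θ.ord ∈ Sset σ.ord θ := by
    refine ⟨(heE _ hθσ).1, ?_⟩
    rw [(he.restr hθσ.le).cof_eq hcf hlθ, hθ.cof_ord]
  have hacc : ∀ ν < (succ θ).ord, ∀ β < e θ.ord, ∃ γ ∈ cgE n σ.ord ν, β < γ ∧ γ < e θ.ord := by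
    intro ν hν β hβ
    obtain ⟨x, hx, h1⟩ := hcf.cof β hβ
    exact ⟨e x, (heE x (hx.trans hθσ)).2 ν hν, h1, hcf.lt x hx⟩
  have hx : ∀ ν, ∃ x, ν < (succ θ).ord → x < θ.ord ∧ b (e θ.ord) x ∈ cgE n σ.ord ν ∧
      b (e θ.ord) x ∉ n (cgE n σ.ord ν) := by
    intro ν
    by_cases hν : ν < (succ θ).ord
    · have := (hn _ (hE ν hν)).2 _ hi (hacc ν hν)
      rw [not_subset] at this
      obtain ⟨_, ⟨⟨x, hx, rfl⟩, h1⟩, h2⟩ := this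
      exact ⟨x, fun _ => ⟨hx, h1, h2⟩⟩
    · exact ⟨0, fun h => absurd h hν⟩
  choose f hf using hx
  refine no_inj hθs f (fun x hx => (hf x hx).1) ?_
  intro ν' ν h1 h2 heq
  have h3 := (hf ν h2).2.1
  rw [cgE] at h3
  have h4 := (h3.2 ν' h1).2
  rw [← heq] at h4
  exact (hf ν' (h1.trans h2)).2.2 h4

theorem clubguess {θ : Cardinal.{u}} (hθ : θ.IsRegular) (hω : ℵ₀ < θ) {σ : Cardinal.{u}} (hσ : σ = succ (succ θ)) :
    ∃ c : Ordinal.{u} → Ordinal.{u} → Ordinal.{u}, ∀ D, IsClubIn D σ.ord → ∃ i ∈ Sset σ.ord θ,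
      Nrm (c i) θ.ord ∧ CofF (c i) θ.ord i ∧ ∀ ε < θ.ord, c i ε ∈ D := by
  have : ∀ i, ∃ b : Ordinal.{u} → Ordinal.{u}, i ∈ Sset σ.ord θ → Nrm b θ.ord ∧ CofF b θ.ord i := by
    intro i
    by_cases hi : i ∈ Sset σ.ord θ
    · have hl : IsSuccLimit i := lim_cof (hi.2 ▸ hω.le)
      obtain ⟨e, h1, h2, -⟩ := NE hl hi.2 (club_univ hl)
      exact ⟨e, fun _ => ⟨h1, h2⟩⟩
    · exact ⟨id, fun h => absurd h hi⟩
  choose b hb using this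
  obtain ⟨E, hE, hg⟩ := cg_exists hθ hσ b
  have hlθ : IsSuccLimit θ.ord := lim_cof (hθ.cof_ord.symm ▸ hθ.aleph0_le)
  have : ∀ i, ∃ c : Ordinal.{u} → Ordinal.{u}, i ∈ Sset σ.ord θ → (∀ β < i, ∃ γ ∈ E, β < γ ∧ γ < i) →
      Nrm c θ.ord ∧ CofF c θ.ord i ∧ ∀ ε < θ.ord, c ε ∈ (b i '' {x | x < θ.ord}) ∩ E := by
    intro i
    by_cases hi : i ∈ Sset σ.ord θ ∧ (∀ β < i, ∃ γ ∈ E, β < γ ∧ γ < i)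
    · have hl : IsSuccLimit i := lim_cof (hi.1.2 ▸ hω.le)
      obtain ⟨h1, h2⟩ := hb i hi.1
      obtain ⟨e, h3, h4, h5⟩ := NE hl hi.1.2 (club_inter2 (hi.1.2 ▸ hω) (h1.range_club h2 hlθ) (club_restr hE hi.1.1 hi.2))
      exact ⟨e, fun _ _ => ⟨h3, h4, fun ε hε => ⟨(h5 ε hε).1, (h5 ε hε).2.1⟩⟩⟩
    · exact ⟨id, fun h h' => absurd ⟨h, h'⟩ hi⟩
  choose c hc using this
  refine ⟨c, fun D hD => ?_⟩
  obtain ⟨i, h1, h2, h3⟩ := hg D hD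
  obtain ⟨h4, h5, h6⟩ := hc i h1 h2
  exact ⟨i, h1, h4, h5, fun ε hε => h3 (h6 ε hε)⟩

theorem Nrm.comp {d c : Ordinal.{u} → Ordinal.{u}} {η ζ i : Ordinal.{u}} (hd : Nrm d η) (hc : Nrm c ζ)
    (hci : ∀ x < ζ, c x < i) (hi : i ≤ η) : Nrm (fun x => d (c x)) ζ := by
  refine ⟨fun a b hab hb => hd.mono _ _ (hc.mono _ _ hab hb) ((hci b hb).trans_le hi), ?_⟩
  intro a ha hl x hx
  have hcf := hc.cofF ha hl
  obtain ⟨b, hb, h1⟩ := hd.cont _ ((hci a ha).trans_le hi) (cofF_lim (hc.restr ha.le) hcf hl) x hx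
  obtain ⟨y, hy, h2⟩ := hcf.cof b hb
  exact ⟨y, hy, h1.trans (hd.mono _ _ h2 ((hci y (hy.trans ha)).trans_le hi))⟩

theorem code3 {lam : Cardinal.{u}} (hlam : ℵ₀ ≤ lam) :
    ∃ p1 p2 p3 : Ordinal.{u} → Ordinal.{u}, ∀ a b c, a < lam.ord → b < lam.ord → c < lam.ord →
      ∃ ξ < lam.ord, p1 ξ = a ∧ p2 ξ = b ∧ p3 ξ = c := by
  classical
  have hcard : #(Iio lam.ord × Iio lam.ord × Iio lam.ord) = #(Iio lam.ord) := by
    have : ℵ₀ ≤ Cardinal.lift.{u+1} lam := by simpa using hlam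
    simp only [mk_prod, Cardinal.lift_id, Cardinal.mk_Iio_ordinal, card_ord]
    rw [mul_eq_self this, mul_eq_self this]
  obtain ⟨q⟩ := Cardinal.eq.1 hcard
  refine ⟨fun ξ => if h : ξ ∈ Iio lam.ord then (q.symm ⟨ξ, h⟩).1 else 0,
    fun ξ => if h : ξ ∈ Iio lam.ord then (q.symm ⟨ξ, h⟩).2.1 else 0,
    fun ξ => if h : ξ ∈ Iio lam.ord then (q.symm ⟨ξ, h⟩).2.2 else 0, ?_⟩
  intro a b c h1 h2 h3
  have h := (q (⟨a, mem_Iio.2 h1⟩, ⟨b, mem_Iio.2 h2⟩, ⟨c, mem_Iio.2 h3⟩)).2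
  refine ⟨_, h, ?_, ?_, ?_⟩ <;> dsimp only <;> rw [dif_pos h] <;> simp only [Subtype.coe_eta, Equiv.symm_apply_apply]

theorem pair2 {lam : Cardinal.{u}} (hlam : ℵ₀ ≤ lam) :
    ∃ p : Ordinal.{u} → Ordinal.{u} → Ordinal.{u}, ∀ a b, a < lam.ord → b < lam.ord → p a b < lam.ord ∧
      ∀ a' b', a' < lam.ord → b' < lam.ord → p a b = p a' b' → a = a' ∧ b = b' := by
  obtain ⟨p1, p2, p3, hp⟩ := code3 hlam
  have : ∀ a b, ∃ ξ, a < lam.ord → b < lam.ord → ξ < lam.ord ∧ p1 ξ = a ∧ p2 ξ = b := by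
    intro a b
    by_cases h : a < lam.ord ∧ b < lam.ord
    · obtain ⟨ξ, h1, h2, h3, -⟩ := hp a b b h.1 h.2 h.2
      exact ⟨ξ, fun _ _ => ⟨h1, h2, h3⟩⟩
    · exact ⟨0, fun h1 h2 => absurd ⟨h1, h2⟩ h⟩
  choose p hp using this
  refine ⟨p, fun a b ha hb => ⟨(hp a b ha hb).1, fun a' b' ha' hb' h => ?_⟩⟩
  have h1 := (hp a b ha hb).2
  have h2 := (hp a' b' ha' hb').2
  rw [h] at h1
  exact ⟨h1.1.symm.trans h2.1, h1.2.symm.trans h2.2⟩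

theorem approach {lam θ : Cardinal.{u}} (hlam : lam.IsRegular) (hθ : θ.IsRegular) (hω : ℵ₀ < θ)
    (hσlam : succ (succ θ) < lam) :
    ∃ F : Ordinal.{u} → Set Ordinal.{u}, (∀ ξ, #(F ξ) ≤ Cardinal.lift.{u+1} θ) ∧
      ∀ E, IsClubIn E lam.ord → ∃ e, Nrm e θ.ord ∧ (∀ ε < θ.ord, e ε ∈ E) ∧
        ∀ γ < θ.ord, ∃ ξ < e (γ + 1), F ξ = e '' {x | x ≤ γ} := by
  classical
  obtain ⟨σ, hσ⟩ : ∃ σ, σ = succ (succ θ) := ⟨_, rfl⟩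
  rw [← hσ] at hσlam
  have hθs : θ < succ θ := lt_succ θ
  have hsσ : succ θ < σ := hσ ▸ lt_succ _
  have hσr : σ.IsRegular := hσ ▸ isRegular_succ (hθ.aleph0_le.trans hθs.le)
  have hωσ : ℵ₀ < σ := (hθ.aleph0_le.trans_lt hθs).trans hsσ
  have hcσ : σ.ord.cof = σ := hσr.cof_ord
  have hcl : lam.ord.cof = lam := hlam.cof_ord
  have hlσ : IsSuccLimit σ.ord := lim_cof (hcσ.symm ▸ hωσ.le)
  have hlθ : IsSuccLimit θ.ord := lim_cof (hθ.cof_ord.symm ▸ hθ.aleph0_le)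
  have hlam0 : 0 < lam.ord := by rw [lt_ord]; simpa using hlam.pos
  obtain ⟨c, hc⟩ := clubguess hθ hω hσ
  have : ∀ α, ∃ b : Ordinal.{u} → Ordinal.{u}, α.cof = σ → Nrm b σ.ord ∧ CofF b σ.ord α := by
    intro i
    by_cases hi : i.cof = σ
    · have hl : IsSuccLimit i := lim_cof (hi ▸ hωσ.le)
      obtain ⟨e, h1, h2, -⟩ := NE hl hi (club_univ hl)
      exact ⟨e, fun _ => ⟨h1, h2⟩⟩
    · exact ⟨id, fun h => absurd h hi⟩
  choose a ha using this
  obtain ⟨p1, p2, p3, hp⟩ := code3 hlam.aleph0_le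
  let F : Ordinal.{u} → Set Ordinal.{u} := fun ξ =>
      (fun ε => a (p1 ξ) (c (p2 ξ) ε)) '' {ε | ε ≤ p3 ξ ∧ ε < θ.ord}
  have hF : ∀ (α i γ : Ordinal.{u}), α < lam.ord → i < lam.ord → γ < θ.ord → ∃ ξ < lam.ord,
      F ξ = (fun ε => a α (c i ε)) '' {ε | ε ≤ γ} := by
    intro α i γ h1 h2 h3
    have h4 : γ < lam.ord := h3.trans (ord_lt_ord.2 ((hθs.trans hsσ).trans hσlam))
    obtain ⟨ξ, hξ, rfl, rfl, rfl⟩ := hp α i γ h1 h2 h4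
    refine ⟨ξ, hξ, ?_⟩
    simp only [F]
    congr 1
    ext ε
    exact ⟨fun h => h.1, fun h => ⟨h, lt_of_le_of_lt h h3⟩⟩
  refine ⟨F, ?_, ?_⟩
  · intro ξ
    refine mk_image_le.trans ?_
    refine (mk_le_mk_of_subset (t := Iio θ.ord) fun x hx => hx.2).trans ?_
    rw [Cardinal.mk_Iio_ordinal, card_ord]
  intro E hE
  let idx : Set Ordinal.{u} → Ordinal.{u} := fun Y => sInf {ξ | ξ < lam.ord ∧ F ξ = Y}
  have hidx : ∀ Y, idx Y < lam.ord := by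
    intro Y
    by_cases h : {ξ | ξ < lam.ord ∧ F ξ = Y}.Nonempty
    · exact (csInf_mem h).1
    · simp only [idx]
      rw [not_nonempty_iff_eq_empty.1 h, Ordinal.sInf_empty]
      exact hlam0
  have hΦ : ∀ d : Ordinal.{u} → Ordinal.{u}, ∃ b < lam.ord, ∀ i < σ.ord, ∀ γ < θ.ord,
      idx ((fun ε => d (c i ε)) '' {ε | ε ≤ γ}) < b := by
    intro d
    have hι : #(Iio σ.ord × Iio θ.ord) < Cardinal.lift.{u+1} lam.ord.cof := by
      simp only [mk_prod, Cardinal.lift_id, Cardinal.mk_Iio_ordinal, card_ord, hcl]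
      rw [← Cardinal.lift_mul, Cardinal.lift_lt]
      exact mul_lt_of_lt hlam.aleph0_le hσlam ((hθs.trans hsσ).trans hσlam)
    obtain ⟨b, hb, h⟩ := bddT hι (fun t => idx ((fun ε => d (c t.1 ε)) '' {ε | ε ≤ t.2})) (fun _ => hidx _)
    exact ⟨b, hb, fun i hi γ hγ => h (⟨i, hi⟩, ⟨γ, hγ⟩)⟩
  choose Φ hΦ1 hΦ2 using hΦ
  obtain ⟨d, hd, hdE, hdΦ⟩ := rec_lemma hσr (hcl.symm ▸ hσlam.le) hE (fun d _ => Φ d) (fun d _ _ _ => hΦ1 d)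
  obtain ⟨α, hα, hdα⟩ := exists_sup hd hlσ (δ := lam.ord) (by rw [hcl, card_ord]; exact hσlam)
    (fun x hx => hE.1 _ (hdE x hx))
  have hαc : α.cof = σ := by rw [hd.cof_eq hdα hlσ, hcσ]
  obtain ⟨ha1, ha2⟩ := ha α hαc
  obtain ⟨i, hi, hci, hci2, hD⟩ := hc _ (hd.agree ha1 hdα ha2 (hcσ.symm ▸ hωσ))
  refine ⟨fun ε => d (c i ε), hd.comp hci hci2.lt hi.1.le, fun ε hε => hdE _ (hD ε hε).1, ?_⟩
  intro γ hγ
  obtain ⟨ξ, hξ, hFξ⟩ := hF α i γ hα (hi.1.trans (ord_lt_ord.2 hσlam)) hγ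
  have hY : (fun ε => a α (c i ε)) '' {ε | ε ≤ γ} = (fun ε => d (c i ε)) '' {ε | ε ≤ γ} := by
    apply image_congr
    intro ε hε
    exact (hD ε (lt_of_le_of_lt hε hγ)).2.symm
  have hne : {ξ | ξ < lam.ord ∧ F ξ = (fun ε => d (c i ε)) '' {ε | ε ≤ γ}}.Nonempty := ⟨ξ, hξ, hFξ.trans hY⟩
  refine ⟨idx ((fun ε => d (c i ε)) '' {ε | ε ≤ γ}), ?_, (csInf_mem hne).2⟩
  have hk := hdΦ (c i γ) (hD γ hγ).1
  have h2 := hΦ2 (tr d (c i γ)) i hi.1 γ hγ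
  have hYt : (fun ε => tr d (c i γ) (c i ε)) '' {ε | ε ≤ γ} = (fun ε => d (c i ε)) '' {ε | ε ≤ γ} := by
    apply image_congr
    intro ε hε
    exact tr_le (hci.le hε hγ)
  rw [hYt] at h2
  refine (h2.trans hk).trans_le ?_
  apply hd.le
  · exact add_one_le_of_lt (hci.mono _ _ (lt_add_one γ) (lim_succ hlθ hγ))
  · exact (hD _ (lim_succ hlθ hγ)).1
end WR

namespace WR
open Ordinal Cardinal Set Order
universe u

theorem mk_bU (s : Set Ordinal.{u}) (A : Ordinal.{u} → Set Ordinal.{u}) {a b : Cardinal.{u}}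
    (hs : #s ≤ Cardinal.lift.{u+1} a) (hA : ∀ x ∈ s, #(A x) ≤ Cardinal.lift.{u+1} b) :
    #{y | ∃ x ∈ s, y ∈ A x} ≤ Cardinal.lift.{u+1} (a * b) := by
  have : {y | ∃ x ∈ s, y ∈ A x} = ⋃ x ∈ s, A x := by ext; simp
  rw [this, Cardinal.lift_mul]
  refine (mk_biUnion_le A s).trans ?_
  refine mul_le_mul' hs ?_
  exact ciSup_le' fun x => hA x.1 x.2

theorem exists_inj {α : Ordinal.{u}} {μ : Cardinal.{u}} (h : α.card ≤ μ) :
    ∃ f : Ordinal.{u} → Ordinal.{u}, (∀ β < α, f β < μ.ord) ∧ ∀ β γ, β < α → γ < α → f β = f γ → β = γ := by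
  classical
  have : #(Iio α) ≤ #(Iio μ.ord) := by
    rw [Cardinal.mk_Iio_ordinal, Cardinal.mk_Iio_ordinal, card_ord, Cardinal.lift_le]; exact h
  obtain ⟨g⟩ := this
  refine ⟨fun β => if h : β ∈ Iio α then g ⟨β, h⟩ else 0, ?_, ?_⟩
  · intro β hβ
    simp only [mem_Iio, hβ, dif_pos]
    exact (g ⟨β, hβ⟩).2
  · intro β γ hβ hγ he
    simp only [mem_Iio, hβ, hγ, dif_pos] at he
    have := g.injective (Subtype.ext he)
    simpa using this

theorem succ_lt_sing {μ κ θ : Cardinal.{u}} (hω : ℵ₀ ≤ θ) (hκμ : κ < μ) (hcof : μ.ord.cof = κ)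
    (h : θ < μ) : succ θ < μ := by
  refine lt_of_le_of_ne (succ_le_of_lt h) ?_
  rintro rfl
  have := (isRegular_succ hω).cof_ord
  rw [hcof] at this
  exact hκμ.ne this

theorem guess {μ κ θ : Cardinal.{u}} (hκ : κ.IsRegular) (hω : ℵ₀ < κ) (hκμ : κ < μ) (hcof : μ.ord.cof = κ)
    (hθ : θ.IsRegular) (hκθ : κ < θ) (hθμ : θ < μ) (hn : ¬ SNR θ.ord κ) :
    ∃ X : Ordinal.{u} → Ordinal.{u} → Set Ordinal.{u}, ∃ ν : Ordinal.{u} → Cardinal.{u},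
      (∀ i < κ.ord, ν i < μ ∧ ∀ δ, #(X δ i) ≤ Cardinal.lift.{u+1} (ν i)) ∧
      ∀ f : Ordinal.{u} → Ordinal.{u}, (∀ x < (succ μ).ord, f x < (succ μ).ord) →
        ∀ E, IsClubIn E (succ μ).ord → ∃ δ ∈ E, δ.cof = κ ∧ ∃ i < κ.ord,
          ∀ x < δ, ∃ ζ, x < ζ ∧ ζ < δ ∧ f ζ ∈ X δ i := by
  classical
  have hωθ : ℵ₀ < θ := hω.trans hκθ
  have hωμ : ℵ₀ < μ := hω.trans hκμ
  have hLr : (succ μ).IsRegular := isRegular_succ hωμ.le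
  have hcκ : κ.ord.cof = κ := hκ.cof_ord
  have hlκ : IsSuccLimit κ.ord := lim_cof (hcκ.symm ▸ hω.le)
  have hlθ : IsSuccLimit θ.ord := lim_cof (hθ.cof_ord.symm ▸ hωθ.le)
  have hcL : (succ μ).ord.cof = succ μ := hLr.cof_ord
  have hωL : ℵ₀ < (succ μ).ord.cof := hcL.symm ▸ hωμ.trans (lt_succ μ)
  have hlμ : IsSuccLimit μ.ord := lim_cof (hcof.symm ▸ hω.le)
  obtain ⟨m, hm, hmc, -⟩ := NE hlμ hcof (club_univ hlμ)
  obtain ⟨F, hF, hFa⟩ := approach hLr hθ hωθ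
    ((succ_lt_sing (hωθ.le.trans (le_succ θ)) hκμ hcof (succ_lt_sing hωθ.le hκμ hcof hθμ)).trans (lt_succ μ))
  have : ∀ α, ∃ f : Ordinal.{u} → Ordinal.{u}, α < (succ μ).ord → (∀ β < α, f β < μ.ord) ∧
      ∀ β γ, β < α → γ < α → f β = f γ → β = γ := by
    intro α
    by_cases h : α < (succ μ).ord
    · obtain ⟨f, hf⟩ := exists_inj (lt_succ_iff.1 (lt_ord.1 h))
      exact ⟨f, fun _ => hf⟩
    · exact ⟨id, fun h' => absurd h' h⟩
  choose inj hinj using this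
  let B : Ordinal.{u} → Ordinal.{u} → Set Ordinal.{u} := fun α i =>
    {β | α < (succ μ).ord ∧ β < α ∧ inj α β < m i}
  have hBmono : ∀ α i i', i ≤ i' → i' < κ.ord → B α i ⊆ B α i' := fun α i i' h1 h2 β hβ =>
    ⟨hβ.1, hβ.2.1, hβ.2.2.trans_le (hm.le h1 h2)⟩
  have hBcov : ∀ α < (succ μ).ord, ∀ β < α, ∃ i < κ.ord, β ∈ B α i := by
    intro α hα β hβ
    obtain ⟨i, hi, h⟩ := hmc.cof _ ((hinj α hα).1 β hβ)
    exact ⟨i, hi, hα, hβ, h⟩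
  have hBcard : ∀ α i, #(B α i) ≤ Cardinal.lift.{u+1} (m i).card := by
    intro α i
    by_cases hα : α < (succ μ).ord
    · rw [← Cardinal.mk_Iio_ordinal]
      refine mk_le_of_injective (f := fun x : B α i => (⟨inj α x, x.2.2.2⟩ : Iio (m i))) ?_
      intro x y hxy
      exact Subtype.ext ((hinj α hα).2 x y x.2.2.1 y.2.2.1 (congrArg Subtype.val hxy))
    · have : B α i = ∅ := by
        ext x; simp only [B, mem_setOf_eq, mem_empty_iff_false, iff_false]
        exact fun h => hα h.1
      rw [this]; simp
  have : ∀ δ, ∃ c : Ordinal.{u} → Ordinal.{u}, δ.cof = κ → Nrm c κ.ord ∧ CofF c κ.ord δ := by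
    intro i
    by_cases hi : i.cof = κ
    · have hl : IsSuccLimit i := lim_cof (hi ▸ hω.le)
      obtain ⟨e, h1, h2, -⟩ := NE hl hi (club_univ hl)
      exact ⟨e, fun _ => ⟨h1, h2⟩⟩
    · exact ⟨id, fun h => absurd h hi⟩
  choose c hc using this
  refine ⟨fun δ i => {y | ∃ ε ∈ {ε | ε < κ.ord}, y ∈ {y | ∃ ξ ∈ B (c δ ε) i, y ∈ {y | ∃ β ∈ F ξ, y ∈ B β i}}},
    fun i => κ * ((m i).card * (θ * (m i).card)), ?_, ?_⟩
  · intro i hi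
    have hmi : (m i).card < μ := lt_ord.1 (hmc.lt i hi)
    refine ⟨mul_lt_of_lt hωμ.le hκμ (mul_lt_of_lt hωμ.le hmi (mul_lt_of_lt hωμ.le hθμ hmi)), fun δ => ?_⟩
    refine mk_bU _ _ ?_ fun ε _ => mk_bU _ _ (hBcard _ _) fun ξ _ => mk_bU _ _ (hF ξ) fun β _ => hBcard _ _
    have := Cardinal.mk_Iio_ordinal κ.ord
    rw [card_ord] at this
    exact this.le
  intro f hf E hE
  obtain ⟨e, he, heE, heF⟩ := hFa _ (club_inter2 hωL hE (club_cp hLr (hωμ.trans (lt_succ μ)) f hf))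
  have heL : ∀ γ < θ.ord, e γ < (succ μ).ord := fun γ hγ => hE.1 _ (heE γ hγ).1
  have hH1 : ∀ γ, ∃ i, γ < θ.ord → i < κ.ord ∧ f (e γ) ∈ B (e (γ+1)) i := by
    intro γ
    by_cases hγ : γ < θ.ord
    · have hγ1 := lim_succ hlθ hγ
      obtain ⟨i, hi, h⟩ := hBcov _ (heL _ hγ1) (f (e γ)) ((heE _ hγ1).2.2.2 _ (he.mono _ _ (lt_add_one γ) hγ1))
      exact ⟨i, fun _ => ⟨hi, h⟩⟩
    · exact ⟨0, fun h => absurd h hγ⟩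
  choose H1 hH1 using hH1
  have hH3 : ∀ γ, ∃ i < κ.ord, γ < θ.ord → IsSuccLimit γ → γ.cof < κ →
      ∀ γ' < γ, ∃ ξ ∈ B (e γ) i, e γ' ∈ F ξ := by
    intro γ
    by_cases hh : γ < θ.ord ∧ IsSuccLimit γ ∧ γ.cof < κ
    · obtain ⟨hγ, hl, hγc⟩ := hh
      obtain ⟨n, hn1, hn2, -⟩ := NE hl rfl (club_univ hl)
      have : ∀ j, ∃ i, j < γ.cof.ord → i < κ.ord ∧ ∃ ξ ∈ B (e γ) i, F ξ = e '' {x | x ≤ n j} := by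
        intro j
        by_cases hj : j < γ.cof.ord
        · have hnj := hn2.lt j hj
          obtain ⟨ξ, hξ, hFξ⟩ := heF (n j) (hnj.trans hγ)
          obtain ⟨i, hi, h⟩ := hBcov (e γ) (heL γ hγ) ξ (hξ.trans (he.mono _ _ (lim_succ hl hnj) hγ))
          exact ⟨i, fun _ => ⟨hi, ξ, h, hFξ⟩⟩
        · exact ⟨0, fun h => absurd h hj⟩
      choose i hi using this
      obtain ⟨b, hb, hb'⟩ := bdd (δ := κ.ord) (η := γ.cof.ord) (by rw [card_ord, hcκ]; exact hγc) i
        (fun x hx => (hi x hx).1)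
      refine ⟨b, hb, fun _ _ _ γ' hγ' => ?_⟩
      obtain ⟨j, hj, h1⟩ := hn2.cof γ' hγ'
      obtain ⟨_, ξ, hξ, hFξ⟩ := hi j hj
      exact ⟨ξ, hBmono _ _ _ (hb' j hj).le hb hξ, hFξ ▸ ⟨γ', h1.le, rfl⟩⟩
    · exact ⟨0, lim_pos hlκ, fun h1 h2 h3 => absurd ⟨h1, h2, h3⟩ hh⟩
  choose H3 hH3a hH3b using hH3
  obtain ⟨δ0, ⟨hδ0, hδ0c⟩, i, hi, hK⟩ := notSNR hκ hω hn (fun γ => max (H1 γ) (H3 γ))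
    (fun γ hγ => max_lt (hH1 γ hγ).1 (hH3a γ))
  have hlδ0 : IsSuccLimit δ0 := lim_cof (hδ0c ▸ hω.le)
  have hce := he.cofF hδ0 hlδ0
  have her := he.restr hδ0.le
  have hδc : (e δ0).cof = κ := by rw [her.cof_eq hce hlδ0, hδ0c]
  refine ⟨e δ0, (heE δ0 hδ0).1, hδc, i, hi, ?_⟩
  obtain ⟨hc1, hc2⟩ := hc _ hδc
  have hωδ0 : ℵ₀ < δ0.cof := hδ0c ▸ hω
  have hK1 := her.preimage_club hce hωδ0 (hc1.range_club hc2 hlκ)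
  obtain ⟨z, hz1, hz2, -⟩ := NE hlδ0 hδ0c (club_univ hlδ0)
  have hK2 := hz1.image_club hz2 (club_lim (hcκ.symm ▸ hω) (club_univ hlκ))
  have hKK := club_inter2 hωδ0 hK1 hK2
  have hlast : ∀ y < δ0, ∃ ζ, y < ζ ∧ ζ < δ0 ∧ H1 ζ ≤ i ∧ H3 ζ ≤ i ∧ IsSuccLimit ζ ∧ ζ.cof < κ ∧
      ∃ ε < κ.ord, c (e δ0) ε = e ζ := by
    intro y hy
    obtain ⟨ζ, hζ, hle⟩ := hK _ (club_inter2 hωδ0 hKK (club_Ioo hlδ0 hy))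
    obtain ⟨⟨⟨h1, ε, hε, h2⟩, ⟨τ, hτ, rfl⟩⟩, h3, h4⟩ := hζ
    have hczτ := hz1.cofF hτ.1 hτ.2.1
    refine ⟨_, h3, h4, (le_max_left _ _).trans hle, (le_max_right _ _).trans hle, ?_, ?_, ε, hε, h2⟩
    · exact cofF_lim (hz1.restr hτ.1.le) hczτ hτ.2.1
    · rw [(hz1.restr hτ.1.le).cof_eq hczτ hτ.2.1]
      exact (cof_le_card τ).trans_lt (lt_ord.1 hτ.1)
  intro x hx
  obtain ⟨y, hy, hxy⟩ := hce.cof x hx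
  obtain ⟨ζ1, hy1, h1, h1a, -⟩ := hlast y hy
  obtain ⟨ζ2, hy2, h2, -, h2b, hl2, hc2', ε, hε, hεe⟩ := hlast (ζ1+1) (lim_succ hlδ0 h1)
  refine ⟨e ζ1, hxy.trans (her.mono _ _ hy1 h1), hce.lt ζ1 h1, ?_⟩
  obtain ⟨ξ, hξ, hFξ⟩ := hH3b ζ2 (h2.trans hδ0) hl2 hc2' (ζ1+1) hy2
  refine ⟨ε, hε, ξ, ?_, e (ζ1+1), hFξ, hBmono _ _ _ h1a hi (hH1 ζ1 (h1.trans hδ0)).2⟩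
  rw [hεe]
  exact hBmono _ _ _ h2b hi hξ
end WR

namespace WR
open Ordinal Cardinal Set Order
universe u

theorem exists_injs (lam : Cardinal.{u}) : ∃ inj : Ordinal.{u} → Ordinal.{u} → Ordinal.{u},
    ∀ α < (succ lam).ord, (∀ β < α, inj α β < lam.ord) ∧
      ∀ β γ, β < α → γ < α → inj α β = inj α γ → β = γ := by
  have : ∀ α, ∃ f : Ordinal.{u} → Ordinal.{u}, α < (succ lam).ord → (∀ β < α, f β < lam.ord) ∧
      ∀ β γ, β < α → γ < α → f β = f γ → β = γ := by
    intro α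
    by_cases h : α < (succ lam).ord
    · obtain ⟨f, hf⟩ := exists_inj (lt_succ_iff.1 (lt_ord.1 h))
      exact ⟨f, fun _ => hf⟩
    · exact ⟨id, fun h' => absurd h' h⟩
  choose inj hinj using this
  exact ⟨inj, hinj⟩

noncomputable def edF (inj : Ordinal.{u} → Ordinal.{u} → Ordinal.{u}) (ζ : Ordinal.{u}) (α : Ordinal.{u}) : Ordinal.{u} :=
  sInf {y | ∀ β, ∀ _h : β < α, inj α β < ζ → edF inj ζ β < y}
termination_by α

/-- bounding a family indexed by `{β < α : inj α β < ζ}` -/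
theorem bdd_inj {lam : Cardinal.{u}} (hlam : lam.IsRegular) {α ζ : Ordinal.{u}} {j : Ordinal.{u} → Ordinal.{u}}
    (hj : ∀ β γ, β < α → γ < α → j β = j γ → β = γ) (hζ : ζ < lam.ord) (φ : Ordinal.{u} → Ordinal.{u})
    (hφ : ∀ β < α, j β < ζ → φ β < lam.ord) : ∃ b < lam.ord, ∀ β < α, j β < ζ → φ β < b := by
  have hι : #{β // β < α ∧ j β < ζ} < Cardinal.lift.{u+1} lam.ord.cof := by
    refine lt_of_le_of_lt (b := #(Iio ζ)) ?_ ?_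
    · refine mk_le_of_injective (f := fun x : {β // β < α ∧ j β < ζ} => (⟨j x, x.2.2⟩ : Iio ζ)) ?_
      intro x y hxy
      exact Subtype.ext (hj x y x.2.1 y.2.1 (congrArg Subtype.val hxy))
    · rw [Cardinal.mk_Iio_ordinal, hlam.cof_ord, Cardinal.lift_lt]
      exact lt_ord.1 hζ
  obtain ⟨b, hb, h⟩ := bddT hι (fun x => φ x.1) (fun x => hφ x.1 x.2.1 x.2.2)
  exact ⟨b, hb, fun β h1 h2 => h ⟨β, h1, h2⟩⟩

theorem evdiff {lam : Cardinal.{u}} (hlam : lam.IsRegular) : ∃ f : Ordinal.{u} → Ordinal.{u} → Ordinal.{u},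
    (∀ α < (succ lam).ord, ∀ ζ < lam.ord, f α ζ < lam.ord) ∧
    ∀ β < (succ lam).ord, ∃ ρ : Ordinal.{u} → Ordinal.{u}, (∀ α < β, ρ α < lam.ord) ∧
      ∀ α α' ζ ζ', α < β → α' < β → α ≠ α' → ρ α < ζ → ρ α' < ζ' → ζ < lam.ord → ζ' < lam.ord →
        f α ζ ≠ f α' ζ' := by
  obtain ⟨inj, hinj⟩ := exists_injs lam
  obtain ⟨p, hp⟩ := pair2 hlam.aleph0_le
  have hlam0 : 0 < lam.ord := by rw [lt_ord]; simpa using hlam.pos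
  have key : ∀ ζ < lam.ord, ∀ α < (succ lam).ord, edF inj ζ α < lam.ord ∧
      ∀ β < α, inj α β < ζ → edF inj ζ β < edF inj ζ α := by
    intro ζ hζ α
    induction α using Ordinal.induction with
    | h α ih =>
      intro hα
      obtain ⟨b, hb, hb'⟩ := bdd_inj hlam (hinj α hα).2 hζ (edF inj ζ)
        (fun β hβ _ => (ih β hβ (hβ.trans hα)).1)
      have h1 : edF inj ζ α = sInf {y | ∀ β, ∀ _h : β < α, inj α β < ζ → edF inj ζ β < y} := by
        rw [edF]
      rw [h1]
      constructor
      · exact (csInf_le' (s := {y | ∀ β, ∀ _h : β < α, inj α β < ζ → edF inj ζ β < y}) hb').trans_lt hb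
      · exact csInf_mem (s := {y | ∀ β, ∀ _h : β < α, inj α β < ζ → edF inj ζ β < y}) ⟨b, hb'⟩
  refine ⟨fun α ζ => p ζ (edF inj ζ α), fun α hα ζ hζ => (hp _ _ hζ (key ζ hζ α hα).1).1, ?_⟩
  intro β hβ
  have hd : ∀ α α', α < β → α' < β → α ≠ α' → max (inj α α') (inj α' α) = max (inj α α') (inj α' α) := fun _ _ _ _ _ => rfl
  clear hd
  let d : Ordinal.{u} → Ordinal.{u} → Ordinal.{u} := fun α α' => inj (max α α') (min α α')
  have hdL : ∀ α α', α < β → α' < β → α ≠ α' → d α α' < lam.ord := by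
    intro α α' h1 h2 h3
    exact (hinj _ ((max_lt h1 h2).trans hβ)).1 _ (min_lt_max.2 h3)
  have hds : ∀ α α', d α α' = d α' α := fun α α' => by simp only [d, max_comm, min_comm]
  have hne : ∀ α α' ζ, α < β → α' < β → α ≠ α' → d α α' < ζ → ζ < lam.ord → edF inj ζ α ≠ edF inj ζ α' := by
    intro α α' ζ h1 h2 h3 h4 h5
    rcases lt_or_gt_of_ne h3 with h | h
    · refine ((key ζ h5 α' (h2.trans hβ)).2 α h ?_).ne
      simpa only [d, max_eq_right h.le, min_eq_left h.le] using h4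
    · refine ((key ζ h5 α (h1.trans hβ)).2 α' h ?_).ne'
      simpa only [d, max_eq_left h.le, min_eq_right h.le] using h4
  have hρ : ∀ α, ∃ b, α < β → b < lam.ord ∧ ∀ α' < β, inj β α' < inj β α → d α α' < b := by
    intro α
    by_cases hα : α < β
    · obtain ⟨b, hb, h⟩ := bdd_inj hlam (hinj β hβ).2 ((hinj β hβ).1 α hα) (d α) (fun α' h1 h2 => by
        refine hdL α α' hα h1 ?_
        rintro rfl
        exact lt_irrefl _ h2)
      exact ⟨b, fun _ => ⟨hb, h⟩⟩
    · exact ⟨0, fun h => absurd h hα⟩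
  choose ρ hρ using hρ
  refine ⟨ρ, fun α hα => (hρ α hα).1, ?_⟩
  intro α α' ζ ζ' h1 h2 h3 h4 h5 h6 h7 heq
  obtain ⟨rfl, h8⟩ := (hp _ _ h6 (key ζ h6 α (h1.trans hβ)).1).2 _ _ h7 (key ζ' h7 α' (h2.trans hβ)).1 heq
  refine hne α α' ζ h1 h2 h3 ?_ h6 h8
  have hne' : inj β α ≠ inj β α' := fun h => h3 ((hinj β hβ).2 _ _ h1 h2 h)
  rcases lt_or_gt_of_ne hne' with h | h
  · rw [hds]
    exact ((hρ α' h2).2 α h1 h).trans h5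
  · exact ((hρ α h1).2 α' h2 h).trans h4

open Classical in
noncomputable def recN (N : (Ordinal.{u} → Ordinal.{u}) → Ordinal.{u}) (inj : Ordinal.{u} → Ordinal.{u} → Ordinal.{u})
    (w0 : Ordinal.{u}) (ν : Ordinal.{u}) : Ordinal.{u} :=
  N (fun ξ => if h : ∃ ν', ν' < ν ∧ inj ν ν' = ξ then recN N inj w0 h.choose else w0)
termination_by ν
decreasing_by exact h.choose_spec.1

theorem stat_not_mem {B A : Set Ordinal.{u}} {L : Ordinal.{u}} (hAB : A ⊆ B) (hA : IsStatIn A L) :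
    (B \ A) ∉ RestFilter (ClubFilter L) B := by
  rintro ⟨Y, ⟨_, C, hC, hCY⟩, h⟩
  obtain ⟨δ, h1, h2⟩ := hA C hC
  have : δ ∈ B \ A := by rw [h]; exact ⟨hCY h2, hAB h1⟩
  exact this.2 h1

theorem bdd_mem {B A : Set Ordinal.{u}} {L ξ : Ordinal.{u}} (hB : ∀ x ∈ B, x < L) (hL : IsSuccLimit L) (hξ : ξ < L)
    (hA : ∀ x ∈ A, x ≤ ξ) : (B \ A) ∈ RestFilter (ClubFilter L) B := by
  refine ⟨Iio L \ A, ⟨diff_subset, _, club_Ioo hL hξ, ?_⟩, ?_⟩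
  · intro x hx
    exact ⟨hx.2, fun h => absurd hx.1 (not_lt.2 (hA x h))⟩
  · ext x
    constructor
    · rintro ⟨h1, h2⟩
      exact ⟨⟨hB x h1, h2⟩, h1⟩
    · rintro ⟨⟨_, h2⟩, h1⟩
      exact ⟨h1, h2⟩

/-- the maximal antichain claim -/
theorem claim {lam : Cardinal.{u}} (hlam : lam.IsRegular) {B : Set Ordinal.{u}} (hB : ∀ x ∈ B, x < lam.ord)
    (hs : SatOn B (RestFilter (ClubFilter lam.ord) B) (succ lam).ord)
    (G : Ordinal.{u} → Set Ordinal.{u}) (hG : ∀ α, G α ⊆ B) (W : Set Ordinal.{u}) (hW : W.Nonempty) :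
    ∃ g : Ordinal.{u} → Ordinal.{u}, (∀ ξ, g ξ ∈ W) ∧
      ∀ α ∈ W, ¬ IsStatIn {δ | δ ∈ G α ∧ ∀ ξ < δ, δ ∉ G (g ξ)} lam.ord := by
  classical
  by_contra hcon
  push Not at hcon
  have hl : IsSuccLimit lam.ord := lim_cof (hlam.cof_ord.symm ▸ hlam.aleph0_le)
  obtain ⟨w0, hw0⟩ := hW
  have : ∀ g : Ordinal.{u} → Ordinal.{u}, ∃ α, (∀ ξ, g ξ ∈ W) → α ∈ W ∧
      IsStatIn {δ | δ ∈ G α ∧ ∀ ξ < δ, δ ∉ G (g ξ)} lam.ord := by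
    intro g
    by_cases hg : ∀ ξ, g ξ ∈ W
    · obtain ⟨α, h⟩ := hcon g hg
      exact ⟨α, fun _ => h⟩
    · exact ⟨0, fun h => absurd h hg⟩
  choose N hN using this
  obtain ⟨inj, hinj⟩ := exists_injs lam
  let a := recN N inj w0
  let g : Ordinal.{u} → Ordinal.{u} → Ordinal.{u} := fun ν ξ =>
    if h : ∃ ν', ν' < ν ∧ inj ν ν' = ξ then a h.choose else w0
  have ha : ∀ ν, a ν = N (g ν) := fun ν => by simp only [a]; rw [recN]
  have haW : ∀ ν, a ν ∈ W := by
    intro ν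
    induction ν using Ordinal.induction with
    | h ν ih =>
      rw [ha]
      refine (hN _ fun ξ => ?_).1
      simp only [g]
      split_ifs with h
      · exact ih _ h.choose_spec.1
      · exact hw0
  have hgW : ∀ ν ξ, g ν ξ ∈ W := by
    intro ν ξ
    simp only [g]
    split_ifs with h
    · exact haW _
    · exact hw0
  have hginj : ∀ ν < (succ lam).ord, ∀ ν' < ν, g ν (inj ν ν') = a ν' := by
    intro ν hν ν' hν'
    have h : ∃ ν'', ν'' < ν ∧ inj ν ν'' = inj ν ν' := ⟨ν', hν', rfl⟩
    have h2 : g ν (inj ν ν') = a h.choose := dif_pos h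
    rw [h2, (hinj ν hν).2 _ _ h.choose_spec.1 hν' h.choose_spec.2]
  apply hs
  refine ⟨fun ν => {δ | δ ∈ G (a ν) ∧ ∀ ξ < δ, δ ∉ G (g ν ξ)}, ?_, ?_⟩
  · intro ν hν
    have hsub : {δ | δ ∈ G (a ν) ∧ ∀ ξ < δ, δ ∉ G (g ν ξ)} ⊆ B := fun x hx => hG _ hx.1
    refine ⟨hsub, stat_not_mem hsub ?_⟩
    have := (hN (g ν) (hgW ν)).2
    rw [← ha] at this
    exact this
  · have main : ∀ ν' ν, ν' < ν → ν < (succ lam).ord → ∀ δ, δ ∈ G (a ν') →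
        (∀ ξ < δ, δ ∉ G (g ν ξ)) → δ ≤ inj ν ν' := by
      intro ν' ν h1 h2 δ h3 h4
      by_contra hn
      apply h4 _ (not_le.1 hn)
      rw [hginj ν h2 ν' h1]
      exact h3
    intro i j hi hj hij
    rcases lt_or_gt_of_ne hij with h | h
    · exact bdd_mem hB hl ((hinj j hj).1 i h) fun x hx => main i j h hj x hx.1.1 hx.2.2
    · exact bdd_mem hB hl ((hinj i hi).1 j h) fun x hx => main j i h hi x hx.2.1 hx.1.2

theorem final {μ κ : Cardinal.{u}} (hκ : κ.IsRegular) (hω : ℵ₀ < κ) (hκμ : κ < μ)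
    (X : Ordinal.{u} → Ordinal.{u} → Set Ordinal.{u}) (ν : Ordinal.{u} → Cardinal.{u})
    (hX : ∀ i < κ.ord, ν i < μ ∧ ∀ δ, #(X δ i) ≤ Cardinal.lift.{u+1} (ν i))
    (hguess : ∀ f : Ordinal.{u} → Ordinal.{u}, (∀ x < (succ μ).ord, f x < (succ μ).ord) →
        ∀ E, IsClubIn E (succ μ).ord → ∃ δ ∈ E, δ.cof = κ ∧ ∃ i < κ.ord,
          ∀ x < δ, ∃ ζ, x < ζ ∧ ζ < δ ∧ f ζ ∈ X δ i) :
    ¬ SatOn (Sset (succ μ).ord κ) (RestFilter (ClubFilter (succ μ).ord) (Sset (succ μ).ord κ))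
      (succ (succ μ)).ord := by
  classical
  intro hs
  have hωμ : ℵ₀ < μ := hω.trans hκμ
  obtain ⟨lam, hlam⟩ : ∃ lam, lam = succ μ := ⟨_, rfl⟩
  rw [← hlam] at hs hguess
  have hμl : μ < lam := hlam ▸ lt_succ μ
  have hlr : lam.IsRegular := hlam ▸ isRegular_succ hωμ.le
  have hpr : (succ lam).IsRegular := isRegular_succ hlr.aleph0_le
  have hcl : lam.ord.cof = lam := hlr.cof_ord
  have hcp : (succ lam).ord.cof = succ lam := hpr.cof_ord
  have hωl : ℵ₀ < lam.ord.cof := hcl.symm ▸ hωμ.trans hμl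
  have hlp : IsSuccLimit (succ lam).ord := lim_cof (hcp.symm ▸ hpr.aleph0_le)
  have hll : IsSuccLimit lam.ord := lim_cof hωl.le
  obtain ⟨f, hf, hfρ⟩ := evdiff hlr
  let G : Ordinal.{u} → Ordinal.{u} → Set Ordinal.{u} := fun i α =>
    {δ | δ ∈ Sset lam.ord κ ∧ ∀ x < δ, ∃ ζ, x < ζ ∧ ζ < δ ∧ f α ζ ∈ X δ i}
  have hstat : ∀ α < (succ lam).ord, ∃ i < κ.ord, IsStatIn (G i α) lam.ord := by
    intro α hα
    by_contra hn
    push Not at hn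
    have : ∀ i, ∃ C, i < κ.ord → IsClubIn C lam.ord ∧ ∀ δ ∈ C, δ ∉ G i α := by
      intro i
      by_cases hi : i < κ.ord
      · have := hn i hi
        unfold IsStatIn at this
        push Not at this
        obtain ⟨C, hC, h⟩ := this
        refine ⟨C, fun _ => ⟨hC, fun δ h1 h2 => ?_⟩⟩
        have : δ ∈ G i α ∩ C := ⟨h2, h1⟩
        rw [h] at this
        exact this
      · exact ⟨∅, fun h => absurd h hi⟩
    choose C hC using this
    obtain ⟨δ, hδ, hδc, i, hi, h⟩ := hguess (f α) (hf α hα) _ (club_inter (η := κ.ord) hωl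
      (by rw [hcl, card_ord]; exact hκμ.trans hμl) C (fun i hi => (hC i hi).1))
    exact (hC i hi).2 δ (hδ.2 i hi) ⟨⟨hδ.1, hδc⟩, h⟩
  have hi : ∃ i < κ.ord, ∀ b < (succ lam).ord, ∃ α, b ≤ α ∧ α < (succ lam).ord ∧ IsStatIn (G i α) lam.ord := by
    by_contra hn
    push Not at hn
    have : ∀ i, ∃ b, i < κ.ord → b < (succ lam).ord ∧ ∀ α, b ≤ α → α < (succ lam).ord → ¬ IsStatIn (G i α) lam.ord := by
      intro i
      by_cases hi : i < κ.ord
      · obtain ⟨b, hb⟩ := hn i hi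
        exact ⟨b, fun _ => hb⟩
      · exact ⟨0, fun h => absurd h hi⟩
    choose b hb using this
    obtain ⟨b', hb', h⟩ := bdd (δ := (succ lam).ord) (η := κ.ord)
      (by rw [hcp, card_ord]; exact (hκμ.trans hμl).trans (lt_succ _)) b (fun i hi => (hb i hi).1)
    obtain ⟨i, hi, h1⟩ := hstat b' hb'
    exact (hb i hi).2 b' (h i hi).le hb' h1
  obtain ⟨i, hi, hunb⟩ := hi
  let W : Ordinal.{u} → Set Ordinal.{u} := fun β =>
    {α | β ≤ α ∧ α < (succ lam).ord ∧ IsStatIn (G i α) lam.ord}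
  have hg : ∀ β, ∃ g : Ordinal.{u} → Ordinal.{u}, β < (succ lam).ord → (∀ ξ, g ξ ∈ W β) ∧
      ∀ α ∈ W β, ¬ IsStatIn {δ | δ ∈ G i α ∧ ∀ ξ < δ, δ ∉ G i (g ξ)} lam.ord := by
    intro β
    by_cases hβ : β < (succ lam).ord
    · obtain ⟨g, hg⟩ := claim hlr (fun x hx => hx.1) hs (G i) (fun α x hx => hx.1) (W β) (hunb β hβ)
      exact ⟨g, fun _ => hg⟩
    · exact ⟨id, fun h => absurd h hβ⟩
  choose gg hgg using hg
  have hΦ : ∀ β, ∃ b, β < (succ lam).ord → b < (succ lam).ord ∧ ∀ ξ < lam.ord, gg β ξ < b := by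
    intro β
    by_cases hβ : β < (succ lam).ord
    · obtain ⟨b, hb⟩ := bdd (δ := (succ lam).ord) (η := lam.ord) (by rw [hcp, card_ord]; exact lt_succ lam)
        (gg β) (fun ξ _ => ((hgg β hβ).1 ξ).2.1)
      exact ⟨b, fun _ => hb⟩
    · exact ⟨0, fun h => absurd h hβ⟩
  choose Φ hΦ using hΦ
  obtain ⟨e, he, heL, heΦ⟩ := rec_lemma hpr (hcp.symm ▸ le_rfl) (club_univ hlp) (fun d k => Φ (d k))
    (fun d k _ hd => (hΦ _ (hd k)).1)
  replace heL : ∀ k < (succ lam).ord, e k < (succ lam).ord := heL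
  have hge : ∀ k < (succ lam).ord, ∀ ξ < lam.ord, gg (e k) ξ < e (k+1) := by
    intro k hk ξ hξ
    have h1 := heΦ k hk
    rw [tr_le le_rfl] at h1
    exact ((hΦ _ (heL k hk)).2 ξ hξ).trans h1
  obtain ⟨τ, hτ⟩ : ∃ τ, τ = succ (ν i) := ⟨_, rfl⟩
  have hτμ : τ ≤ μ := hτ ▸ succ_le_of_lt (hX i hi).1
  have hτp : τ.ord < (succ lam).ord := ord_lt_ord.2 ((hτμ.trans_lt hμl).trans (lt_succ lam))
  obtain ⟨ρ, hρ1, hρ2⟩ := hfρ _ (heL _ hτp)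
  obtain ⟨α, hα1, hα2, hα3⟩ := hunb _ (heL _ hτp)
  have hlt : ∀ k < τ.ord, ∀ ξ < lam.ord, gg (e k) ξ < e τ.ord := fun k hk ξ hξ =>
    (hge k (hk.trans hτp) ξ hξ).trans_le (he.le (add_one_le_of_lt hk) hτp)
  have hK : ∀ k, ∃ C, k < τ.ord → IsClubIn C lam.ord ∧ ∀ δ ∈ C, δ ∈ G i α → ∃ ξ < δ, δ ∈ G i (gg (e k) ξ) := by
    intro k
    by_cases hk : k < τ.ord
    · have := (hgg (e k) (heL k (hk.trans hτp))).2 α ⟨(he.le hk.le hτp).trans hα1, hα2, hα3⟩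
      unfold IsStatIn at this
      push Not at this
      obtain ⟨C, hC, h⟩ := this
      refine ⟨C, fun _ => ⟨hC, fun δ h1 h2 => ?_⟩⟩
      by_contra hn
      push Not at hn
      have : δ ∈ {δ | δ ∈ G i α ∧ ∀ ξ < δ, δ ∉ G i (gg (e k) ξ)} ∩ C := ⟨⟨h2, hn⟩, h1⟩
      rw [h] at this
      exact this
    · exact ⟨∅, fun h => absurd h hk⟩
  choose C hC using hK
  have hclub := club_inter (δ := lam.ord) (η := τ.ord) hωl (by rw [hcl, card_ord]; exact hτμ.trans_lt hμl)
    (fun k => C k ∩ {x | x < lam.ord ∧ IsSuccLimit x ∧ ∀ ξ < x, ρ (gg (e k) ξ) < x})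
    (fun k hk => club_inter2 hωl (hC k hk).1 (club_cp hlr (hωμ.trans hμl) _ (fun ξ hξ => hρ1 _ (hlt k hk ξ hξ))))
  obtain ⟨δ, hδG, hδL, hδ⟩ := hα3 _ hclub
  have hy : ∀ k : Iio τ.ord, ∃ a ζ, e k ≤ a ∧ a < e (k.1+1) ∧ a < e τ.ord ∧ ρ a < ζ ∧ ζ < lam.ord ∧ f a ζ ∈ X δ i := by
    rintro ⟨k, hk⟩
    have hk' : k < τ.ord := hk
    obtain ⟨h1, h2⟩ := hδ k hk'
    obtain ⟨ξ, hξ, h3⟩ := (hC k hk').2 δ h1 hδG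
    obtain ⟨ζ, h4, h5, h6⟩ := h3.2 _ (h2.2.2 ξ hξ)
    exact ⟨gg (e k) ξ, ζ, ((hgg (e k) (heL k (hk'.trans hτp))).1 ξ).1, hge k (hk'.trans hτp) ξ (hξ.trans hδL),
      hlt k hk' ξ (hξ.trans hδL), h4, h5.trans hδL, h6⟩
  choose a ζ hy using hy
  have hane : ∀ k k' : Iio τ.ord, k.1 < k'.1 → a k ≠ a k' := by
    intro k k' h
    refine ((hy k).2.1.trans_le (le_trans ?_ (hy k').1)).ne
    exact he.le (add_one_le_of_lt h) (lt_trans k'.2 hτp)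
  have hcard : #(Iio τ.ord) ≤ #(X δ i) := by
    refine mk_le_of_injective (f := fun k : Iio τ.ord => (⟨f (a k) (ζ k), (hy k).2.2.2.2.2⟩ : X δ i)) ?_
    intro k k' hkk
    have hkk' : f (a k) (ζ k) = f (a k') (ζ k') := congrArg Subtype.val hkk
    by_contra hne
    have hne' : k.1 ≠ k'.1 := fun h => hne (Subtype.ext h)
    have haa : a k ≠ a k' := by
      rcases lt_or_gt_of_ne hne' with h | h
      · exact hane k k' h
      · exact (hane k' k h).symm
    exact hρ2 (a k) (a k') (ζ k) (ζ k') (hy k).2.2.1 (hy k').2.2.1 haa (hy k).2.2.2.1 (hy k').2.2.2.1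
      (hy k).2.2.2.2.1 (hy k').2.2.2.2.1 hkk'
  rw [Cardinal.mk_Iio_ordinal, card_ord] at hcard
  have := hcard.trans ((hX i hi).2 δ)
  rw [Cardinal.lift_le, hτ] at this
  exact absurd (lt_succ (ν i)) (not_lt.2 this)
end WR

theorem stmt10 (μ κ : Cardinal) (h1 : Cardinal.aleph0 < κ) (h2 : κ < μ)
    (h3 : Ordinal.cof μ.ord = κ)
    (θ : Ordinal) (h4 : κ.ord < θ) (h5 : θ < (Order.succ μ).ord)
    (h6 : ¬ SNR θ κ) :
    ¬ SatOn (Sset (Order.succ μ).ord κ)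
        (RestFilter (ClubFilter (Order.succ μ).ord) (Sset (Order.succ μ).ord κ))
        (Order.succ (Order.succ μ)).ord := by
  have hκ : κ.IsRegular := by
    rw [← h3]
    exact Cardinal.isRegular_cof (WR.lim_cof (by rw [h3]; exact h1.le))
  have : ∃ χ : Cardinal, χ.IsRegular ∧ κ < χ ∧ χ < μ ∧ ¬ SNR χ.ord κ := by
    by_contra hn
    push Not at hn
    exact h6 (WR.snr_all h1 h2 h3 hn θ h5)
  obtain ⟨χ, hχ, hκχ, hχμ, hns⟩ := this
  obtain ⟨X, ν, hX, hg⟩ := WR.guess hκ h1 h2 h3 hχ hκχ hχμ hns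
  exact WR.final hκ h1 h2 X ν hX hg
end

section
/- Suppose λ = μ⁺ and μ > cf(μ) = κ > ℵ₀. Then no normal filter D on λ with λ∖S^λ_κ ∈ D is λ⁺-saturated. -/
/-- `D` is a (proper) normal filter on `λ`: a `λ`-complete filter of subsets of
`λ` containing all final segments and closed under diagonal intersections. -/
def IsNormalFilterOn (lam : Ordinal) (D : Set (Set Ordinal)) : Prop :=
  (∀ X ∈ D, X ⊆ Set.Iio lam) ∧
  Set.Iio lam ∈ D ∧
  ∅ ∉ D ∧
  (∀ X ∈ D, ∀ Y, Y ⊆ Set.Iio lam → X ⊆ Y → Y ∈ D) ∧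
  (∀ ν < lam, ∀ X : Ordinal → Set Ordinal, (∀ i < ν, X i ∈ D) →
    (Set.Iio lam ∩ ⋂ i ∈ Set.Iio ν, X i) ∈ D) ∧
  (∀ α < lam, {β | α < β ∧ β < lam} ∈ D) ∧
  (∀ X : Ordinal → Set Ordinal, (∀ α < lam, X α ∈ D) →
    {β | β < lam ∧ ∀ α < β, β ∈ X α} ∈ D)


section AuxLemmas

open Filter Cardinal Ordinal

universe u

lemma aux_card_le {a b : Ordinal.{u}} (f : Ordinal.{u} → Ordinal.{u})
    (hf : ∀ x < a, f x < b) (hi : ∀ x < a, ∀ y < a, f x = f y → x = y) : a.card ≤ b.card := by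
  have h : #(Set.Iio a) ≤ #(Set.Iio b) :=
    Cardinal.mk_le_of_injective (f := fun x : Set.Iio a => (⟨f x.1, hf _ x.2⟩ : Set.Iio b))
      (fun x y h => Subtype.ext (hi _ x.2 _ y.2 (congrArg Subtype.val h)))
  rw [Cardinal.mk_Iio_ordinal, Cardinal.mk_Iio_ordinal] at h
  exact Cardinal.lift_le.1 h

lemma aux_card_le_sq {a b : Ordinal.{u}} (f g : Ordinal.{u} → Ordinal.{u})
    (hf : ∀ x < a, f x < b) (hg : ∀ x < a, g x < b)
    (hi : ∀ x < a, ∀ y < a, f x = f y → g x = g y → x = y) : a.card ≤ b.card * b.card := by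
  have h : #(Set.Iio a) ≤ #(Set.Iio b × Set.Iio b) :=
    Cardinal.mk_le_of_injective
      (f := fun x : Set.Iio a =>
        ((⟨f x.1, hf _ x.2⟩ : Set.Iio b), (⟨g x.1, hg _ x.2⟩ : Set.Iio b)))
      (fun x y h => Subtype.ext (hi _ x.2 _ y.2 (congrArg (fun z => z.1.1) h)
        (congrArg (fun z => z.2.1) h)))
  rw [Cardinal.mk_prod, Cardinal.mk_Iio_ordinal, Cardinal.mk_Iio_ordinal, Cardinal.lift_id,
    ← Cardinal.lift_mul] at h
  exact Cardinal.lift_le.1 h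

lemma aux_inj {a b : Ordinal.{u}} (h : a.card ≤ b.card) : ∃ f : Ordinal.{u} → Ordinal.{u},
    (∀ x < a, f x < b) ∧ (∀ x < a, ∀ y < a, f x = f y → x = y) := by
  have h' : #(Set.Iio a) ≤ #(Set.Iio b) := by
    rw [Cardinal.mk_Iio_ordinal, Cardinal.mk_Iio_ordinal]
    exact Cardinal.lift_le.2 h
  obtain ⟨e⟩ := h'
  refine ⟨fun x => if hx : x < a then (e ⟨x, hx⟩).1 else 0, ?_, ?_⟩
  · intro x hx
    simp only [hx, dif_pos]
    exact (e ⟨x, hx⟩).2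
  · intro x hx y hy hxy
    simp only [hx, hy, dif_pos] at hxy
    exact congrArg Subtype.val (e.injective (Subtype.ext hxy))

lemma aux_sSup {a ν : Ordinal.{u}} (h : ν.card < a.cof) (f : Ordinal.{u} → Ordinal.{u})
    (hf : ∀ i < ν, f i < a) : sSup ((· + 1) '' (f '' Set.Iio ν)) < a := by
  apply Ordinal.sSup_add_one_lt_of_lt_cof
  · refine lt_of_le_of_lt Cardinal.mk_image_le ?_
    rw [Cardinal.mk_Iio_ordinal, ← Ordinal.lift_cof]
    exact Cardinal.lift_lt.2 h
  · rintro _ ⟨i, hi, rfl⟩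
    exact hf i hi

lemma aux_lt_sSup {ν : Ordinal.{u}} (f : Ordinal.{u} → Ordinal.{u}) :
    ∀ i < ν, f i < sSup ((· + 1) '' (f '' Set.Iio ν)) := by
  intro i hi
  refine lt_of_lt_of_le (b := f i + 1) (by simp) ?_
  exact le_csSup (bddAbove_of_small) ⟨f i, ⟨i, hi, rfl⟩, rfl⟩

lemma aux_bdd {a ν : Ordinal.{u}} (h : ν.card < a.cof) (P : Ordinal.{u} → Ordinal.{u} → Prop)
    (hP : ∀ i < ν, ∃ c < a, ∀ b, c ≤ b → P i b) : ∃ b < a, ∀ i < ν, P i b := by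
  choose! f hf hfP using hP
  exact ⟨_, aux_sSup h f hf, fun i hi => hfP i hi _ (aux_lt_sSup f i hi).le⟩

/-- iteration sequence -/
noncomputable def aux_seq (f : Ordinal.{u} → Ordinal.{u}) (c : Ordinal.{u}) (i : Ordinal.{u}) :
    Ordinal.{u} :=
  max c (sSup ((· + 1) '' (Set.range fun j : Set.Iio i => f (aux_seq f c j.1))))
termination_by i
decreasing_by exact j.2

lemma aux_seq_eq (f : Ordinal.{u} → Ordinal.{u}) (c i : Ordinal.{u}) :
    aux_seq f c i = max c (sSup ((· + 1) '' ((fun j => f (aux_seq f c j)) '' Set.Iio i))) := by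
  rw [aux_seq, Set.image_eq_range (fun j => f (aux_seq f c j)) (Set.Iio i)]

lemma aux_seq_exists {a : Ordinal.{u}} (ha : ∀ i < a, i.card < a.cof)
    (f : Ordinal.{u} → Ordinal.{u}) (hf : ∀ i < a, f i < a) (c : Ordinal.{u}) (hc : c < a) :
    ∃ s : Ordinal.{u} → Ordinal.{u}, (∀ i < a, s i < a) ∧ (∀ i, c ≤ s i) ∧
      ∀ i j, j < i → f (s j) < s i := by
  refine ⟨aux_seq f c, ?_, ?_, ?_⟩
  · intro i
    induction i using WellFoundedLT.induction with
    | ind i ih =>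
      intro hi
      rw [aux_seq_eq]
      exact max_lt hc (aux_sSup (ha i hi) _ (fun j hj => hf _ (ih j hj (hj.trans hi))))
  · intro i
    rw [aux_seq_eq]
    exact le_max_left _ _
  · intro i j hj
    rw [aux_seq_eq f c i]
    exact lt_of_lt_of_le (aux_lt_sSup (fun j => f (aux_seq f c j)) j hj) (le_max_right _ _)

/-- eventually different functions -/
noncomputable def aux_g (r : Ordinal.{u} → Ordinal.{u} → Ordinal.{u}) (ξ β : Ordinal.{u}) :
    Ordinal.{u} :=
  sInf {y | ∀ α : Set.Iio β, r β α.1 < ξ → y ≠ aux_g r ξ α.1}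
termination_by β
decreasing_by exact α.2

lemma aux_g_spec {μ : Cardinal.{u}} (r : Ordinal.{u} → Ordinal.{u} → Ordinal.{u})
    (β ξ : Ordinal.{u}) (hξ : ξ < (Order.succ μ).ord)
    (hr : ∀ x < β, ∀ y < β, r β x = r β y → x = y) :
    aux_g r ξ β < (Order.succ μ).ord ∧ ∀ α < β, r β α < ξ → aux_g r ξ β ≠ aux_g r ξ α := by
  have hne : ∃ y < (Order.succ μ).ord, ∀ α < β, r β α < ξ → y ≠ aux_g r ξ α := by
    by_contra hcon
    push Not at hcon
    choose! A hA0 hA1 hA2 using hcon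
    have := aux_card_le (a := (Order.succ μ).ord) (b := ξ) (fun y => r β (A y)) hA1 (by
      intro x hx y hy hxy
      have := hr _ (hA0 x hx) _ (hA0 y hy) hxy
      rw [hA2 x hx, hA2 y hy, this])
    rw [Cardinal.card_ord] at this
    exact absurd (Cardinal.lt_ord.1 hξ) (not_lt.2 this)
  obtain ⟨y, hy, hy1⟩ := hne
  have hy2 : y ∈ {y | ∀ α : Set.Iio β, r β α.1 < ξ → y ≠ aux_g r ξ α.1} :=
    fun α hα => hy1 α.1 α.2 hα
  rw [aux_g]
  have hmem := csInf_mem (s := {y | ∀ α : Set.Iio β, r β α.1 < ξ → y ≠ aux_g r ξ α.1}) ⟨y, hy2⟩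
  refine ⟨lt_of_le_of_lt (csInf_le' hy2) hy, ?_⟩
  intro α hα h
  exact hmem ⟨α, hα⟩ h

lemma aux_cof {δ κo : Ordinal.{u}} (hκ : κo.cof = κo.card)
    (hne : δ.cof ≠ κo.cof)
    (ι : Ordinal.{u} → Ordinal.{u}) (hι : ∀ ξ < δ, ι ξ < κo) :
    ∃ i < κo, ∀ ζ < δ, ∃ ξ, ζ ≤ ξ ∧ ξ < δ ∧ ι ξ ≤ i := by
  by_contra hcon
  push Not at hcon
  choose! z hz hz2 using hcon
  rcases lt_or_gt_of_ne hne with h | h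
  · obtain ⟨f, hf⟩ := Ordinal.exists_isFundamentalSeq (o := δ) rfl
    have hb := aux_bdd (a := κo) (ν := δ.cof.ord) (by rwa [Cardinal.card_ord])
      (fun i b => ∀ hi : i < δ.cof.ord, ι (f ⟨i, hi⟩).1 ≤ b)
      (fun i hi => ⟨ι (f ⟨i, hi⟩).1, hι _ (f ⟨i, hi⟩).2, fun b hb _ => hb⟩)
    obtain ⟨b, hb, hb2⟩ := hb
    obtain ⟨_, ⟨⟨j, hj⟩, rfl⟩, hj2⟩ := hf.isCofinal_range ⟨z b, hz b hb⟩
    exact absurd (hb2 j hj hj) (not_le.2 (hz2 b hb _ hj2 (f ⟨j, hj⟩).2))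
  · obtain ⟨b, hb, hb2⟩ := aux_bdd (a := δ) (ν := κo) (by rwa [← hκ]) (fun i b => z i ≤ b)
      (fun i hi => ⟨z i, hz i hi, fun b hb => hb⟩)
    exact absurd (hz2 (ι b) (hι b hb) b (hb2 _ (hι b hb)) hb) (lt_irrefl _)

/-- data about a saturated normal filter -/
structure aux_NF (F : Filter Ordinal.{u}) (L Lp : Ordinal.{u}) : Prop where
  ne : F.NeBot
  lt : ∀ᶠ δ in F, δ < L
  gt : ∀ α < L, ∀ᶠ δ in F, α < δ
  compl : ∀ ν < L, ∀ P : Ordinal.{u} → Ordinal.{u} → Prop, (∀ i < ν, ∀ᶠ δ in F, P i δ) →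
    ∀ᶠ δ in F, ∀ i < ν, P i δ
  diag : ∀ P : Ordinal.{u} → Ordinal.{u} → Prop, (∀ i < L, ∀ᶠ δ in F, P i δ) →
    ∀ᶠ δ in F, ∀ i < δ, P i δ
  sat : ∀ A : Ordinal.{u} → Ordinal.{u} → Prop, (∀ i < Lp, ∃ᶠ δ in F, A i δ) →
    (∀ i j, i < Lp → j < i → ∀ᶠ δ in F, A i δ → A j δ → False) → False

lemma aux_NF.diag' {F : Filter Ordinal.{u}} {L Lp : Ordinal.{u}} (h : aux_NF F L Lp)
    (β : Ordinal.{u}) (r : Ordinal.{u} → Ordinal.{u})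
    (hr : ∀ x < β, ∀ y < β, r x = r y → x = y)
    (P : Ordinal.{u} → Ordinal.{u} → Prop) (hP : ∀ α < β, ∀ᶠ δ in F, P α δ) :
    ∀ᶠ δ in F, ∀ α < β, r α < δ → P α δ := by
  have := h.diag (fun i δ => ∀ α < β, r α = i → P α δ) (by
    intro i hi
    by_cases hex : ∃ α < β, r α = i
    · obtain ⟨α, hα, rfl⟩ := hex
      filter_upwards [hP α hα] with δ hδ α' hα' he
      rwa [hr _ hα' _ hα he]
    · exact Eventually.of_forall fun δ α hα he => absurd ⟨α, hα, he⟩ hex)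
  filter_upwards [this] with δ hδ α hα hl
  exact hδ _ hl α hα rfl

lemma aux_stage4 {F : Filter Ordinal.{u}} {L Lp : Ordinal.{u}} (h : aux_NF F L Lp)
    (hLLp : L < Lp)
    (hreg : ∀ i < Lp, i.card < Lp.cof)
    (r : Ordinal.{u} → Ordinal.{u} → Ordinal.{u})
    (hrL : ∀ β < Lp, ∀ α < β, r β α < L)
    (hr : ∀ β < Lp, ∀ x < β, ∀ y < β, r β x = r β y → x = y)
    (X : Ordinal.{u} → Ordinal.{u} → Prop)
    (hX : ∀ γ < Lp, ∃ α, γ ≤ α ∧ α < Lp ∧ ∃ᶠ δ in F, X α δ) :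
    ∃ β < Lp, ∃ᶠ δ in F, ∃ s : Ordinal.{u} → Ordinal.{u},
      (∀ x < δ, ∀ y < δ, s x = s y → x = y) ∧
      ∀ ξ < δ, s ξ < β ∧ r β (s ξ) < δ ∧ X (s ξ) δ := by
  set W : Ordinal.{u} → Ordinal.{u} → Ordinal.{u} → Prop := fun γ γ' δ =>
    ∃ α, γ ≤ α ∧ α < γ' ∧ r γ' α < δ ∧ X α δ with hW
  have hWone : ∀ γ γ' α, γ ≤ α → α < γ' → γ' < Lp → ∀ᶠ δ in F, X α δ → W γ γ' δ := by
    intro γ γ' α h1 h2 h3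
    filter_upwards [h.gt _ (hrL γ' h3 α h2)] with δ hδ hx
    exact ⟨α, h1, h2, hδ, hx⟩
  have claimA : ∀ γ < Lp, ∃ γ', γ ≤ γ' ∧ γ' < Lp ∧
      ∀ α, γ ≤ α → α < Lp → ∀ᶠ δ in F, X α δ → W γ γ' δ := by
    intro γ hγ
    by_contra hcon
    push Not at hcon
    have hcon2 : ∀ γ' < Lp, γ ≤ γ' → ∃ α, γ' ≤ α ∧ α < Lp ∧ ∃ᶠ δ in F, X α δ ∧ ¬ W γ γ' δ := by
      intro γ' h1 h2
      obtain ⟨α, h3, h4, h5⟩ := hcon γ' h2 h1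
      refine ⟨α, ?_, h4, ?_⟩
      · by_contra hlt
        exact absurd (hWone γ γ' α h3 (not_le.1 hlt) h1) (by
          simpa [Filter.not_eventually] using h5)
      · simpa [Filter.not_eventually] using h5
    choose! a ha1 ha2 ha3 using hcon2
    obtain ⟨s, hs1, hs2, hs3⟩ := aux_seq_exists (a := Lp) hreg
      (fun i => if γ ≤ i then a i else 0) (by
        intro i hi
        split_ifs with hh
        · exact ha2 i hi hh
        · exact lt_of_le_of_lt (zero_le) hi) γ hγ
    refine h.sat (fun i δ => X (a (s i)) δ ∧ ¬ W γ (s i) δ)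
      (fun i hi => ha3 _ (hs1 i hi) (hs2 i)) ?_
    intro i j hi hj
    have hjL := hj.trans hi
    have h3 := hs3 i j hj
    simp only [hs2, if_true] at h3
    filter_upwards [hWone γ (s i) (a (s j)) ((hs2 j).trans (ha1 _ (hs1 j hjL) (hs2 j))) h3
      (hs1 i hi)] with δ hδ hi2 hj2
    exact hi2.2 (hδ hj2.1)
  choose! f hf1 hf2 hf3 using claimA
  set Z : Ordinal.{u} → Ordinal.{u} → Prop := fun γ δ => W γ (f γ) δ with hZ
  have hZmono : ∀ γ₁ γ₂, γ₁ ≤ γ₂ → γ₂ < Lp → ∀ᶠ δ in F, Z γ₂ δ → Z γ₁ δ := by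
    intro γ₁ γ₂ h12 h2
    have h1 := lt_of_le_of_lt h12 h2
    have := h.diag' (f γ₂) (r (f γ₂)) (hr _ (hf2 _ h2))
      (fun α δ => γ₂ ≤ α → X α δ → Z γ₁ δ) (by
        intro α hα
        by_cases hle : γ₂ ≤ α
        · filter_upwards [hf3 γ₁ h1 α (h12.trans hle) (hα.trans (hf2 _ h2))] with δ hδ _ hx
          exact hδ hx
        · exact Eventually.of_forall fun δ hh => absurd hh hle)
    filter_upwards [this] with δ hδ
    rintro ⟨α, ha, hb, hc, hd⟩
    exact hδ α hb hc ha hd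
  have claimB : ∃ γ < Lp, ∀ γ', γ ≤ γ' → γ' < Lp → ∀ᶠ δ in F, Z γ δ → Z γ' δ := by
    by_contra hcon
    push Not at hcon
    choose! p hp1 hp2 hp3 using hcon
    obtain ⟨s, hs1, hs2, hs3⟩ := aux_seq_exists (a := Lp) hreg p hp2 0
      (lt_of_le_of_lt zero_le hLLp)
    refine h.sat (fun i δ => Z (s i) δ ∧ ¬ Z (p (s i)) δ) ?_ ?_
    · intro i hi
      have := hp3 _ (hs1 i hi)
      simpa [Filter.not_eventually] using this
    · intro i j hi hj
      filter_upwards [hZmono _ _ (hs3 i j hj).le (hs1 i hi)] with δ hδ hi2 hj2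
      exact hj2.2 (hδ hi2.1)
  obtain ⟨γ, hγ, hγ2⟩ := claimB
  obtain ⟨s, hs1, hs2, hs3⟩ := aux_seq_exists (a := Lp) hreg f hf2 γ hγ
  refine ⟨s L, hs1 L hLLp, ?_⟩
  obtain ⟨α, hα1, hα2, hα3⟩ := hX γ hγ
  have hZpos : ∃ᶠ δ in F, Z γ δ := (hα3.and_eventually (hf3 γ hγ α hα1 hα2)).mono
    fun δ hδ => hδ.2 hδ.1
  have hmain := h.diag (fun ξ δ => Z γ δ → ∃ α, s ξ ≤ α ∧ α < f (s ξ) ∧ α < s L ∧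
      r (s L) α < δ ∧ X α δ) (by
    intro ξ hξ
    have hξp := hξ.trans hLLp
    have h4 := h.diag' (f (s ξ)) (r (f (s ξ))) (hr _ (hf2 _ (hs1 _ hξp)))
      (fun α δ => r (s L) α < δ)
      (fun α hα => h.gt _ (hrL _ (hs1 L hLLp) _ (hα.trans (hs3 L ξ hξ))))
    filter_upwards [hγ2 (s ξ) (hs2 ξ) (hs1 _ hξp), h4] with δ hδ h4 hz
    obtain ⟨α, ha, hb, hc, hd⟩ := hδ hz
    exact ⟨α, ha, hb, hb.trans (hs3 L ξ hξ), h4 α hb hc, hd⟩)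
  refine (hZpos.and_eventually hmain).mono ?_
  rintro δ ⟨hz, hδ⟩
  have hδ' : ∀ i < δ, ∃ α, s i ≤ α ∧ α < f (s i) ∧ α < s L ∧ r (s L) α < δ ∧ X α δ :=
    fun i hi => hδ i hi hz
  choose! t ht1 ht2 ht3 ht4 ht5 using hδ'
  refine ⟨t, ?_, fun ξ hξ => ⟨ht3 ξ hξ, ht4 ξ hξ, ht5 ξ hξ⟩⟩
  have key : ∀ x < δ, ∀ y < δ, x < y → t x < t y := fun x hx y hy hxy =>
    (ht2 x hx).trans ((hs3 y x hxy).trans_le (ht1 y hy))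
  intro x hx y hy hxy
  rcases lt_trichotomy x y with hlt | heq | hgt
  · exact absurd hxy (key x hx y hy hlt).ne
  · exact heq
  · exact absurd hxy (key y hy x hx hgt).ne'

lemma aux_filter (μ : Cardinal.{u}) (hμ : ℵ₀ ≤ μ) (D : Set (Set Ordinal.{u}))
    (hD : IsNormalFilterOn (Order.succ μ).ord D)
    (hs : SatOn (Set.Iio (Order.succ μ).ord) D (Order.succ (Order.succ μ)).ord) :
    ∃ F : Filter Ordinal.{u}, aux_NF F (Order.succ μ).ord (Order.succ (Order.succ μ)).ord ∧
      ∀ X ∈ D, ∀ᶠ δ in F, δ ∈ X := by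
  obtain ⟨hsub, huniv, hemp, hup, hcomp, hfin, hdiag⟩ := hD
  set L := (Order.succ μ).ord with hL
  have hL2 : (2 : Ordinal.{u}) < L := by
    rw [hL, Cardinal.lt_ord]
    have : Ordinal.card (2 : Ordinal.{u}) = 2 := by simp
    rw [this]
    exact lt_of_lt_of_le (Cardinal.nat_lt_aleph0 2) (hμ.trans (Order.le_succ μ))
  have hinter : ∀ X ∈ D, ∀ Y ∈ D, X ∩ Y ∈ D := by
    intro X hX Y hY
    have := hcomp 2 hL2 (fun i => if i = 0 then X else Y) (by
      intro i _
      split_ifs <;> assumption)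
    refine hup _ this _ (fun x hx => hsub X hX hx.1) ?_
    rintro x ⟨_, hx⟩
    simp only [Set.mem_iInter, Set.mem_Iio] at hx
    have h0 := hx 0 (by norm_num)
    have h1 := hx 1 (by norm_num)
    simp at h0 h1
    exact ⟨h0, h1⟩
  let F : Filter Ordinal.{u} :=
    { sets := {X | Set.Iio L ∩ X ∈ D}
      univ_sets := by simpa using huniv
      sets_of_superset := by
        intro X Y hX hXY
        exact hup _ hX _ Set.inter_subset_left (Set.inter_subset_inter_right _ hXY)
      inter_sets := by
        intro X Y hX hY
        refine hup _ (hinter _ hX _ hY) _ Set.inter_subset_left ?_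
        rintro x ⟨⟨h1, h2⟩, _, h3⟩
        exact ⟨h1, h2, h3⟩ }
  have hF : ∀ P : Ordinal.{u} → Prop, (∀ᶠ δ in F, P δ) ↔ Set.Iio L ∩ {δ | P δ} ∈ D :=
    fun P => Iff.rfl
  have hDF : ∀ X ∈ D, ∀ᶠ δ in F, δ ∈ X := by
    intro X hX
    rw [hF]
    exact hinter _ huniv _ hX
  refine ⟨F, ⟨⟨?_⟩, ?_, ?_, ?_, ?_, ?_⟩, hDF⟩
  · intro hbot
    have : ∀ᶠ δ in F, False := by rw [hbot]; simp
    rw [hF] at this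
    simp at this
    exact hemp this
  · exact (hDF _ huniv)
  · intro α hα
    filter_upwards [hDF _ (hfin α hα)] with δ hδ using hδ.1
  · intro ν hν P hP
    have := hDF _ (hcomp ν hν (fun i => Set.Iio L ∩ {δ | P i δ}) (fun i hi => hP i hi))
    filter_upwards [this] with δ hδ i hi
    have h2 := hδ.2
    simp only [Set.mem_iInter] at h2
    exact (h2 i hi).2
  · intro P hP
    have := hDF _ (hdiag (fun i => Set.Iio L ∩ {δ | P i δ}) (fun i hi => hP i hi))
    filter_upwards [this] with δ hδ i hi
    exact (hδ.2 i hi).2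
  · intro A hA hA2
    refine hs ⟨fun i => Set.Iio L ∩ {δ | A i δ}, ?_, ?_⟩
    · intro i hi
      refine ⟨Set.inter_subset_left, fun hmem => ?_⟩
      refine hA i hi ?_
      filter_upwards [hDF _ hmem] with δ hδ ha
      exact hδ.2 ⟨hδ.1, ha⟩
    · have key : ∀ i j, i < (Order.succ (Order.succ μ)).ord → j < i →
          Set.Iio L \ ((Set.Iio L ∩ {δ | A i δ}) ∩ (Set.Iio L ∩ {δ | A j δ})) ∈ D := by
        intro i j hi hj
        refine hup _ ((hF _).1 (hA2 i j hi hj)) _ Set.sdiff_subset ?_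
        rintro x ⟨hx, hx2⟩
        exact ⟨hx, fun hh => hx2 hh.1.2 hh.2.2⟩
      intro i j hi hj hne
      rcases lt_or_gt_of_ne hne with hlt | hlt
      · have := key j i hj hlt
        rwa [Set.inter_comm] at this
      · exact key i j hi hlt

lemma aux_main (μ κ : Cardinal.{u}) (h1 : ℵ₀ < κ) (h2 : κ < μ)
    (h3 : Ordinal.cof μ.ord = κ) (F : Filter Ordinal.{u})
    (hNF : aux_NF F (Order.succ μ).ord (Order.succ (Order.succ μ)).ord)
    (hS : ∀ᶠ δ in F, Ordinal.cof δ ≠ κ) : False := by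
  have hμ : ℵ₀ ≤ μ := (h1.trans h2).le
  have hμ1 : ℵ₀ ≤ Order.succ μ := hμ.trans (Order.le_succ μ)
  have hregL : (Order.succ μ).ord.cof = Order.succ μ := (Cardinal.isRegular_succ hμ).cof_ord
  have hregLp : (Order.succ (Order.succ μ)).ord.cof = Order.succ (Order.succ μ) :=
    (Cardinal.isRegular_succ hμ1).cof_ord
  set L := (Order.succ μ).ord with hL
  set Lp := (Order.succ (Order.succ μ)).ord with hLp
  have hLLp : L < Lp := Cardinal.ord_lt_ord.2 (Order.lt_succ _)
  have hμL : μ.ord < L := Cardinal.ord_lt_ord.2 (Order.lt_succ _)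
  have hκμ : κ.ord < μ.ord := Cardinal.ord_lt_ord.2 h2
  have hcardLp : ∀ i < Lp, i.card ≤ Order.succ μ := fun i hi =>
    Order.lt_succ_iff.1 (Cardinal.lt_ord.1 hi)
  have hcardL : ∀ i < L, i.card ≤ μ := fun i hi =>
    Order.lt_succ_iff.1 (Cardinal.lt_ord.1 hi)
  have := hNF.ne
  -- injections
  have hr : ∀ β < Lp, ∃ f : Ordinal.{u} → Ordinal.{u}, (∀ x < β, f x < L) ∧
      (∀ x < β, ∀ y < β, f x = f y → x = y) := fun β hβ =>
    aux_inj (by rw [hL, Cardinal.card_ord]; exact hcardLp β hβ)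
  choose! r hrL hrinj using hr
  have hh : ∀ δ < L, ∃ f : Ordinal.{u} → Ordinal.{u}, (∀ x < δ, f x < μ.ord) ∧
      (∀ x < δ, ∀ y < δ, f x = f y → x = y) := fun δ hδ =>
    aux_inj (by rw [Cardinal.card_ord]; exact hcardL δ hδ)
  choose! h hhμ hhinj using hh
  -- the functions
  obtain ⟨g, hgL, hgne⟩ : ∃ g : Ordinal.{u} → Ordinal.{u} → Ordinal.{u},
      (∀ β < Lp, ∀ ξ < L, g β ξ < L) ∧
      (∀ β < Lp, ∀ α < β, ∀ ξ < L, r β α < ξ → g β ξ ≠ g α ξ) :=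
    ⟨fun β ξ => aux_g r ξ β, fun β hβ ξ hξ => (aux_g_spec r β ξ hξ (hrinj β hβ)).1,
      fun β hβ α hα ξ hξ hlt => (aux_g_spec r β ξ hξ (hrinj β hβ)).2 α hα hlt⟩
  -- cofinal sequence in μ
  obtain ⟨m, hm1, hm2, hm3⟩ : ∃ m : Ordinal.{u} → Ordinal.{u}, (∀ i < κ.ord, m i < μ.ord) ∧
      (∀ i j, i ≤ j → j < κ.ord → m i ≤ m j) ∧ (∀ x < μ.ord, ∃ i < κ.ord, x ≤ m i) := by
    obtain ⟨f, hf⟩ := Ordinal.exists_isFundamentalSeq (o := μ.ord) (a := κ.ord) (by rw [h3])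
    refine ⟨fun i => if hi : i < κ.ord then (f ⟨i, hi⟩).1 else 0, ?_, ?_, ?_⟩
    · intro i hi
      simp only [hi, dif_pos]
      exact (f ⟨i, hi⟩).2
    · intro i j hij hj
      have hi := lt_of_le_of_lt hij hj
      simp only [hi, hj, dif_pos]
      exact hf.strictMono.monotone (show (⟨i, hi⟩ : Set.Iio κ.ord) ≤ ⟨j, hj⟩ from hij)
    · intro x hx
      obtain ⟨_, ⟨⟨j, hj⟩, rfl⟩, hj2⟩ := hf.isCofinal_range ⟨x, hx⟩
      refine ⟨j, hj, ?_⟩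
      change x ≤ if hi : j < κ.ord then (f ⟨j, hi⟩).1 else 0
      rw [dif_pos (show j < κ.ord from hj)]
      exact hj2
  have hκcof : κ.ord.cof = κ.ord.card := by
    rw [Cardinal.card_ord, ← h3, Ordinal.cof_ord_cof]
  -- stage 2
  set U : Ordinal.{u} → Ordinal.{u} → Ordinal.{u} → Prop := fun i α δ =>
    ∀ ζ < δ, ∃ ξ, ζ ≤ ξ ∧ ξ < δ ∧ g α ξ < δ ∧ h δ ξ ≤ m i ∧ h δ (g α ξ) ≤ m i with hU
  have st2 : ∀ α < Lp, ∃ i < κ.ord, ∃ᶠ δ in F, U i α δ := by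
    intro α hα
    by_contra hcon
    push Not at hcon
    have hc := hNF.compl κ.ord (hκμ.trans hμL) (fun i δ => ¬ U i α δ)
      (fun i hi => by simpa using hcon i hi)
    have hd := hNF.diag (fun ξ δ => g α ξ < δ) (fun ξ hξ => hNF.gt _ (hgL α hα ξ hξ))
    obtain ⟨δ, hδc, hδd, hδS, hδL⟩ := (hc.and (hd.and (hS.and hNF.lt))).exists
    have hι : ∀ ξ < δ, ∃ i < κ.ord, h δ ξ ≤ m i ∧ h δ (g α ξ) ≤ m i := by
      intro ξ hξ
      obtain ⟨i, hi, hi2⟩ := hm3 (max (h δ ξ) (h δ (g α ξ)))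
        (max_lt (hhμ δ hδL ξ hξ) (hhμ δ hδL _ (hδd ξ hξ)))
      exact ⟨i, hi, (le_max_left _ _).trans hi2, (le_max_right _ _).trans hi2⟩
    choose! ι hι1 hι2 hι3 using hι
    obtain ⟨i, hi, hi2⟩ := aux_cof hκcof (by rwa [hκcof, Cardinal.card_ord]) ι hι1
    refine hδc i hi ?_
    intro ζ hζ
    obtain ⟨ξ, ha, hb, hc⟩ := hi2 ζ hζ
    exact ⟨ξ, ha, hb, hδd ξ hb, (hι2 ξ hb).trans (hm2 _ _ hc hi),
      (hι3 ξ hb).trans (hm2 _ _ hc hi)⟩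
  -- stage 3
  have st3 : ∃ i < κ.ord, ∀ γ < Lp, ∃ α, γ ≤ α ∧ α < Lp ∧ ∃ᶠ δ in F, U i α δ := by
    by_contra hcon
    push Not at hcon
    obtain ⟨b, hb, hb2⟩ := aux_bdd (a := Lp) (ν := κ.ord)
      (by rw [hregLp, Cardinal.card_ord]
          exact h2.trans ((Order.lt_succ _).trans (Order.lt_succ _)))
      (fun i b => ¬ ∃ᶠ δ in F, b < Lp ∧ U i b δ) (by
        intro i hi
        obtain ⟨γ, hγ, hγ2⟩ := hcon i hi
        refine ⟨γ, hγ, fun b hb hf => ?_⟩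
        obtain ⟨_, hbL, _⟩ := hf.exists
        refine hf ?_
        have := hγ2 b hb hbL
        filter_upwards [this] with δ hδ hh
        exact hδ hh.2)
    obtain ⟨i, hi, hi2⟩ := st2 b hb
    exact hb2 i hi (hi2.mono fun δ hδ => ⟨hb, hδ⟩)
  obtain ⟨i, hi, hiU⟩ := st3
  obtain ⟨β, hβ, hβ2⟩ := aux_stage4 hNF hLLp
    (fun i hi => by rw [hregLp]; exact Cardinal.lt_ord.1 hi) r hrL hrinj (U i) hiU
  -- disjointifying
  have hdis : ∀ α < β, ∃ b < L, ∀ η < r β α, ∀ α' < β, r β α' = η → ∀ ξ < L, b ≤ ξ →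
      g α ξ ≠ g α' ξ := by
    intro α hα
    refine aux_bdd (a := L) (ν := r β α)
      (by rw [hregL]; exact Cardinal.lt_ord.1 (hrL β hβ α hα))
      (fun η b => ∀ α' < β, r β α' = η → ∀ ξ < L, b ≤ ξ → g α ξ ≠ g α' ξ) ?_
    intro η hη
    by_cases hex : ∃ α' < β, r β α' = η
    · obtain ⟨α', hα', rfl⟩ := hex
      have hsuc : ∀ x < L, x + 1 < L := fun x hx =>
        (Cardinal.isSuccLimit_ord hμ1).add_one_lt hx
      rcases lt_trichotomy α α' with hlt | heq | hgt
      · refine ⟨r α' α + 1, hsuc _ (hrL _ (hα'.trans hβ) _ hlt), ?_⟩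
        intro b hb α'' hα'' he ξ hξ hbξ
        rw [hrinj β hβ _ hα'' _ hα' he]
        exact (hgne _ (hα'.trans hβ) _ hlt ξ hξ
          (lt_of_lt_of_le (by simp) (hb.trans hbξ))).symm
      · subst heq
        exact absurd hη (lt_irrefl _)
      · refine ⟨r α α' + 1, hsuc _ (hrL _ (hα.trans hβ) _ hgt), ?_⟩
        intro b hb α'' hα'' he ξ hξ hbξ
        rw [hrinj β hβ _ hα'' _ hα' he]
        exact (hgne _ (hα.trans hβ) _ hgt ξ hξ
          (lt_of_lt_of_le (by simp) (hb.trans hbξ)))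
    · exact ⟨0, lt_of_le_of_lt zero_le hμL,
        fun b _ α' hα' he => absurd ⟨α', hα', he⟩ hex⟩
  choose! f hfL hf using hdis
  have hfd := hNF.diag' β (r β) (hrinj β hβ) (fun α δ => f α < δ)
    (fun α hα => hNF.gt _ (hfL α hα))
  obtain ⟨δ, ⟨s, hsinj, hs⟩, hfδ, hδL, hδμ⟩ :=
    (hβ2.and_eventually (hfd.and (hNF.lt.and (hNF.gt _ hμL)))).exists
  have hpick : ∀ η < δ, ∃ ξ, f (s η) ≤ ξ ∧ ξ < δ ∧ g (s η) ξ < δ ∧ h δ ξ ≤ m i ∧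
      h δ (g (s η) ξ) ≤ m i := by
    intro η hη
    obtain ⟨ha, hb, hc⟩ := hs η hη
    exact hc _ (hfδ _ ha hb)
  choose! x hx1 hx2 hx3 hx4 hx5 using hpick
  have hcard := aux_card_le_sq (a := δ) (b := m i + 1) (fun η => h δ (x η))
    (fun η => h δ (g (s η) (x η)))
    (fun η hη => Order.lt_add_one_iff.2 (hx4 η hη))
    (fun η hη => Order.lt_add_one_iff.2 (hx5 η hη)) (by
      intro a ha b hb hab hab2
      have e1 := hhinj δ hδL _ (hx2 a ha) _ (hx2 b hb) hab
      have e2 := hhinj δ hδL _ (hx3 a ha) _ (hx3 b hb) hab2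
      by_contra hne
      have hsne : s a ≠ s b := fun hh => hne (hsinj a ha b hb hh)
      have hrne : r β (s a) ≠ r β (s b) := fun hh =>
        hsne (hrinj β hβ _ (hs a ha).1 _ (hs b hb).1 hh)
      rcases lt_or_gt_of_ne hrne with hlt | hlt
      · refine hf (s b) (hs b hb).1 _ hlt (s a) (hs a ha).1 rfl (x b)
          ((hx2 b hb).trans hδL) (hx1 b hb) ?_
        rw [← e2, e1]
      · refine hf (s a) (hs a ha).1 _ hlt (s b) (hs b hb).1 rfl (x a)
          ((hx2 a ha).trans hδL) (hx1 a ha) ?_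
        rw [e2, e1])
  have hmi : (m i + 1).card < μ :=
    Cardinal.lt_ord.1 ((Cardinal.isSuccLimit_ord hμ).add_one_lt (hm1 i hi))
  have hlt := lt_of_le_of_lt hcard (Cardinal.mul_lt_of_lt hμ hmi hmi)
  exact absurd (Cardinal.lt_ord.2 hlt) (not_lt.2 hδμ.le)

end AuxLemmas

/-- Corollary 2.9(1): if `λ = μ⁺` and `μ > cf(μ) = κ > ℵ₀`, then no normal
filter `D` on `λ` with `λ ∖ S^λ_κ ∈ D` is `λ⁺`-saturated. -/
theorem stmt18 (μ κ : Cardinal) (h1 : Cardinal.aleph0 < κ) (h2 : κ < μ)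
    (h3 : Ordinal.cof μ.ord = κ)
    (D : Set (Set Ordinal)) (hD : IsNormalFilterOn (Order.succ μ).ord D)
    (hSD : (Set.Iio (Order.succ μ).ord \ Sset (Order.succ μ).ord κ) ∈ D) :
    ¬ SatOn (Set.Iio (Order.succ μ).ord) D (Order.succ (Order.succ μ)).ord := by
  intro hs
  obtain ⟨F, hNF, hDF⟩ := aux_filter μ (h1.trans h2).le D hD hs
  refine aux_main μ κ h1 h2 h3 F hNF ?_
  filter_upwards [hDF _ hSD] with δ hδ hc
  exact hδ.2 ⟨hδ.1, hc⟩
end
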